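/- arXiv:2108.13623 — 6 statements merged into one kernel-verified Lean document; each statement's English description precedes it below -/
import Mathlib

section
/- Let k and l be positive integers. In the exterior algebra Λ, det(Ω)^l = C · ∏_{s=1}^{l} ∏_{i=1}^{k} (ψ^i_s ∧ ψ̄^i_s), where the scalar C equals Σ_{M∈𝓜_{l,k}} (∏_{a,b=1}^{k} m_{a,b}!) · mul(M)² (the factors ψ^i_s ∧ ψ̄^i_s are even elements, so the order of the product is immaterial). -/
open scoped BigOperators

/-- Matrices with all row sums and column sums equal to `l`. -/
def IsMagic (k l : ℕ) (M : Matrix (Fin k) (Fin k) ℕ) : Prop :=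
  (∀ a, ∑ b, M a b = l) ∧ (∀ b, ∑ a, M a b = l)

/-- Permutation matrix `R(σ)` with natural number entries. -/
def permMat (k : ℕ) (σ : Equiv.Perm (Fin k)) : Matrix (Fin k) (Fin k) ℕ :=
  Matrix.of fun a b => if σ a = b then 1 else 0

/-- Permutation matrix `R(σ)` with integer entries. -/
def permMatZ (k : ℕ) (σ : Equiv.Perm (Fin k)) : Matrix (Fin k) (Fin k) ℤ :=
  Matrix.of fun a b => if σ a = b then 1 else 0

/-- The determinant of the generic `k × k` matrix of indeterminates over `ℚ`. -/
noncomputable def detX (k : ℕ) : MvPolynomial (Fin k × Fin k) ℚ :=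
  Matrix.det (Matrix.of fun a b : Fin k => MvPolynomial.X (a, b))

/-- `mul_l(M)`: the coefficient of the monomial `∏ x_{a,b}^{M a b}` in `det(X)^l`. -/
noncomputable def mulCoeff (k l : ℕ) (M : Matrix (Fin k) (Fin k) ℕ) : ℚ :=
  MvPolynomial.coeff (Finsupp.equivFunOnFinite.symm fun p : Fin k × Fin k => M p.1 p.2)
    (detX k ^ l)

open Classical in
/-- `mul_l` extended to integer matrices: it is `0` when some entry is negative. -/
noncomputable def mulCoeffZ (k l : ℕ) (M : Matrix (Fin k) (Fin k) ℤ) : ℚ :=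
  if ∀ a b, 0 ≤ M a b then mulCoeff k l (Matrix.of fun a b => (M a b).toNat) else 0

open scoped BigOperators

/-- The exterior algebra over `ℝ` on the `2kl` generators `ψ^i_s`, `ψ̄^i_s`
(`1 ≤ i ≤ k`, `1 ≤ s ≤ l`). -/
abbrev Lam (k l : ℕ) : Type :=
  ExteriorAlgebra ℝ (((Fin k × Fin l) ⊕ (Fin k × Fin l)) → ℝ)

/-- The generator `ψ^i_s`. -/
noncomputable def psi (k l : ℕ) (i : Fin k) (s : Fin l) : Lam k l :=
  ExteriorAlgebra.ι ℝ (Pi.single (Sum.inl (i, s)) 1)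

/-- The generator `ψ̄^i_s`. -/
noncomputable def psibar (k l : ℕ) (i : Fin k) (s : Fin l) : Lam k l :=
  ExteriorAlgebra.ι ℝ (Pi.single (Sum.inr (i, s)) 1)

/-- `Ω_{i,j} = Σ_{s=1}^{l} ψ^i_s ∧ ψ̄^j_s`. -/
noncomputable def Omega (k l : ℕ) (i j : Fin k) : Lam k l :=
  ∑ s, psi k l i s * psibar k l j s

/-- `det(Ω) = Σ_{σ ∈ S_k} sgn(σ) ∏_{a=1}^{k} Ω_{a,σ(a)}` (the entries `Ω_{i,j}` are even hence
commute, so the ordered product below agrees with any ordering of the factors). -/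
noncomputable def detOmega (k l : ℕ) : Lam k l :=
  ∑ σ : Equiv.Perm (Fin k),
    (Equiv.Perm.sign σ : ℤ) • (List.ofFn fun a => Omega k l a (σ a)).prod

/-- The product `∏_{s=1}^{l} ∏_{i=1}^{k} ψ^i_s ∧ ψ̄^i_s` (the factors are even hence commute,
so the ordering is immaterial). -/
noncomputable def topProd (k l : ℕ) : Lam k l :=
  (List.ofFn fun s : Fin l =>
    (List.ofFn fun i : Fin k => psi k l i s * psibar k l i s).prod).prod

section CommRing

variable {B : Type*} [CommRing B]

theorem eq_zero_of_eq_neg_of_ratHom (φ : ℚ →+* B) {b : B} (h : b = -b) : b = 0 := by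
  have h2 : φ (1 / 2) * 2 = 1 := by
    rw [← map_ofNat φ 2, ← map_mul]; norm_num
  linear_combination φ (1 / 2) * h - b * h2

/-- If `ω i j * ω i' j'` is antisymmetric in `j`, `j'`, two rows paired with the same vector multiply to zero. -/
theorem rowSum_mul_rowSum_eq_zero {n : Type*} [Fintype n] (φ : ℚ →+* B) (ω : n → n → B)
    (h : ∀ i j i' j', ω i j * ω i' j' = -(ω i j' * ω i' j)) (v : n → B) (i i' : n) :
    (∑ j, v j * ω i j) * (∑ j, v j * ω i' j) = 0 := by
  apply eq_zero_of_eq_neg_of_ratHom φ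
  rw [Finset.sum_mul_sum]
  conv_rhs => rw [Finset.sum_comm]
  simp only [← Finset.sum_neg_distrib]
  refine Finset.sum_congr rfl fun j _ => Finset.sum_congr rfl fun j' _ => ?_
  linear_combination v j * v j' * h i j i' j'

theorem prod_rowSum_eq_det_mul {n : Type*} [Fintype n] [DecidableEq n] (φ : ℚ →+* B)
    (ω : n → n → B) (h : ∀ i j i' j', ω i j * ω i' j' = -(ω i j' * ω i' j))
    (X : Matrix n n B) :
    ∏ i, ∑ j, X i j * ω i j = X.det * ∏ i, ω i i := by
  let F : (n → B) [⋀^n]→ₗ[B] B :=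
    { (MultilinearMap.mkPiAlgebra B n B).compLinearMap
        (fun i => ∑ j, (LinearMap.proj j : (n → B) →ₗ[B] B).smulRight (ω i j)) with
      map_eq_zero_of_eq' := by
        intro v i i' hv hne
        have key := rowSum_mul_rowSum_eq_zero φ ω h (v i) i i'
        simp only [MultilinearMap.toFun_eq_coe, MultilinearMap.compLinearMap_apply,
          MultilinearMap.mkPiAlgebra_apply, LinearMap.sum_apply, LinearMap.smulRight_apply,
          LinearMap.proj_apply, smul_eq_mul]
        rw [← Finset.mul_prod_erase _ _ (Finset.mem_univ i),
          ← Finset.mul_prod_erase _ _ (Finset.mem_erase.2 ⟨hne.symm, Finset.mem_univ i'⟩),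
          ← mul_assoc, ← hv, key, zero_mul] }
  have hF : ∀ v : n → n → B, F v = ∏ i, ∑ j, v i j * ω i j := by
    intro v
    change ((MultilinearMap.mkPiAlgebra B n B).compLinearMap _) v = _
    simp
  have hdet : F X = F (Pi.basisFun B n) * X.det := by
    conv_lhs => rw [F.eq_smul_basis_det (Pi.basisFun B n)]
    exact congrArg (_ * ·) (Pi.basisFun_det_apply X)
  rw [← hF X, hdet, hF, mul_comm]
  congr 1
  simp [Pi.single_apply]

theorem sum_pow_of_sq_eq_zero {ι : Type*} (s : Finset ι) (v : ι → B) (hv : ∀ i, v i * v i = 0) :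
    (∑ i ∈ s, v i) ^ s.card = (s.card.factorial : B) * ∏ i ∈ s, v i ∧
      (∑ i ∈ s, v i) ^ (s.card + 1) = 0 := by
  classical
  induction s using Finset.induction_on with
  | empty => simp
  | insert a s ha ih =>
    obtain ⟨h1, h2⟩ := ih
    have key : ∀ m : ℕ, (v a + ∑ i ∈ s, v i) ^ (m + 1) =
        (∑ i ∈ s, v i) ^ (m + 1) + (m + 1) * v a * (∑ i ∈ s, v i) ^ m := by
      intro m
      induction m with
      | zero => simp; ring
      | succ m ihm =>
        rw [pow_succ, ihm]
        push_cast
        linear_combination (m + 1) * (∑ i ∈ s, v i) ^ m * hv a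
    rw [Finset.sum_insert ha, Finset.prod_insert ha, Finset.card_insert_of_notMem ha]
    refine ⟨?_, ?_⟩
    · rw [key, h1, h2, Nat.factorial_succ]; push_cast; ring
    · rw [key, h2, pow_succ, h2]; ring

open MvPolynomial in
theorem coeff_sum_C_mul_X_pow {σ : Type*} [Fintype σ] (a : σ → B) (m : σ →₀ ℕ) :
    coeff m ((∑ p, X p * C (a p)) ^ (∑ p, m p)) =
      (Nat.multinomial Finset.univ m : B) * ∏ p, a p ^ m p := by
  classical
  rw [Finset.sum_pow_eq_sum_piAntidiag, coeff_sum]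
  have hterm : ∀ n : σ → ℕ, coeff m ((Nat.multinomial Finset.univ n : MvPolynomial σ B) *
      ∏ p, (X p * C (a p)) ^ n p) =
      if n = m then (Nat.multinomial Finset.univ n : B) * ∏ p, a p ^ n p else 0 := by
    intro n
    have hmon : (∏ p, (X p : MvPolynomial σ B) ^ n p) =
        monomial (Finsupp.equivFunOnFinite.symm n) 1 := by
      rw [monomial_eq, Finsupp.prod_fintype _ _ (by simp)]
      simp
    have : (Nat.multinomial Finset.univ n : MvPolynomial σ B) * ∏ p, (X p * C (a p)) ^ n p =
        C ((Nat.multinomial Finset.univ n : B) * ∏ p, a p ^ n p) *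
          monomial (Finsupp.equivFunOnFinite.symm n) 1 := by
      simp only [mul_pow, Finset.prod_mul_distrib, hmon, map_mul, map_natCast, map_prod, map_pow]
      ring
    rw [this, coeff_C_mul, coeff_monomial]
    by_cases hn : n = m
    · subst hn; simp
    · rw [if_neg, if_neg hn, mul_zero]
      rintro rfl
      exact hn (by ext; simp)
  rw [Finset.sum_congr rfl fun n _ => hterm n, Finset.sum_ite_eq' _ (m : σ → ℕ)]
  rw [if_pos]
  simp

end CommRing

open MvPolynomial in
theorem isMagic_of_coeff_detX_pow_ne_zero {k l : ℕ} {m : Fin k × Fin k →₀ ℕ}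
    (hm : coeff m (detX k ^ l) ≠ 0) : IsMagic k l (fun a b => m (a, b)) := by
  classical
  have hdet : detX k = ∑ σ : Equiv.Perm (Fin k),
      C ((Equiv.Perm.sign σ : ℤ) : ℚ) * ∏ i, X (σ i, i) := by
    simp [detX, Matrix.det_apply']
  have key : ∀ w : Fin k × Fin k → ℕ,
      (∀ σ : Equiv.Perm (Fin k), ∑ i, w (σ i, i) = 1) → ∑ p, m p * w p = l := by
    intro w hw
    have h1 : IsWeightedHomogeneous w (detX k) 1 := by
      rw [hdet]
      refine IsWeightedHomogeneous.sum _ _ _ fun σ _ => ?_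
      have := IsWeightedHomogeneous.prod Finset.univ (fun i => (X (σ i, i) : MvPolynomial _ ℚ))
        (fun i => w (σ i, i)) (w := w) (fun i _ => isWeightedHomogeneous_X ℚ w (σ i, i))
      rw [hw σ] at this
      simpa using (isWeightedHomogeneous_C w ((Equiv.Perm.sign σ : ℤ) : ℚ)).mul this
    have h2 := h1.pow l hm
    rw [Finsupp.weight_apply, Finsupp.sum_fintype _ _ (by simp)] at h2
    simpa using h2
  constructor
  · intro a
    have := key (fun p => if p.1 = a then 1 else 0) (fun σ => by
      simp [← Equiv.eq_symm_apply])
    simpa [Fintype.sum_prod_type, Finset.sum_comm (s := (Finset.univ : Finset (Fin k)))] using this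
  · intro b
    have := key (fun p => if p.2 = b then 1 else 0) (fun σ => by simp)
    simpa [Fintype.sum_prod_type] using this

section CommRing

variable {A : Type*} [CommRing A]

open MvPolynomial in
theorem map_detX {R : Type*} [CommRing R] (φ : ℚ →+* R) (k : ℕ) (Y : Matrix (Fin k) (Fin k) R) :
    eval₂Hom φ (fun p => Y p.1 p.2) (detX k) = Y.det := by
  rw [detX, RingHom.map_det]
  congr 1
  ext i j
  simp

open MvPolynomial in
theorem prod_sum_pow_eq (φ : ℚ →+* A) {k l : ℕ} (ω : Fin k → Fin k → Fin l → A)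
    (h : ∀ s i j i' j', ω i j s * ω i' j' s = -(ω i j' s * ω i' j s))
    (m : Fin k × Fin k →₀ ℕ) (hm : ∑ p, m p = l * k) :
    ∏ p, (∑ s, ω p.1 p.2 s) ^ m p =
      φ ((∏ p, ((m p).factorial : ℚ)) * coeff m (detX k ^ l)) * ∏ s, ∏ i, ω i i s := by
  have hC : ∀ s i j i' j', (C (ω i j s) * C (ω i' j' s) : MvPolynomial (Fin k × Fin k) A) =
      -(C (ω i j' s) * C (ω i' j s)) := fun s i j i' j' => by
    rw [← map_mul, h, map_neg, map_mul]
  let φ' : ℚ →+* MvPolynomial (Fin k × Fin k) A := C.comp φ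
  let V : Fin l × Fin k → MvPolynomial (Fin k × Fin k) A := fun q =>
    ∑ j, X (q.2, j) * C (ω q.2 j q.1)
  have hV : ∀ q, V q * V q = 0 := fun q =>
    rowSum_mul_rowSum_eq_zero φ' (fun i j => C (ω i j q.1)) (hC q.1) _ _ _
  have hpow := (sum_pow_of_sq_eq_zero Finset.univ V hV).1
  have hdet : eval₂Hom φ' (fun p => (X p : MvPolynomial (Fin k × Fin k) A)) (detX k ^ l) =
      (Matrix.det (Matrix.of fun a b => (X (a, b) : MvPolynomial (Fin k × Fin k) A))) ^ l := by
    rw [map_pow, ← map_detX φ']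
    rfl
  have hmap : eval₂Hom φ' (fun p => (X p : MvPolynomial (Fin k × Fin k) A)) (detX k ^ l) =
      map φ (detX k ^ l) := 
    RingHom.congr_fun (ringHom_ext (by simp [φ']) (by simp)) _
  have hprod : ∏ q, V q = map φ (detX k ^ l) * C (∏ s, ∏ i, ω i i s) := by
    rw [← hmap, hdet, Fintype.prod_prod_type]
    have := fun s => prod_rowSum_eq_det_mul φ' (fun i j => C (ω i j s)) (hC s)
      (Matrix.of fun a b => (X (a, b) : MvPolynomial (Fin k × Fin k) A))
    simp only [Matrix.of_apply] at this
    simp only [V, this, Finset.prod_mul_distrib, map_prod]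
    simp
  have hsum : ∑ q, V q = ∑ p : Fin k × Fin k, X p * C (∑ s, ω p.1 p.2 s) := by
    simp only [V, Fintype.sum_prod_type, map_sum, Finset.mul_sum]
    rw [Finset.sum_comm]
    exact Finset.sum_congr rfl fun i _ => Finset.sum_comm
  have hcard : (Finset.univ : Finset (Fin l × Fin k)).card = ∑ p, m p := by simp [hm]
  rw [hcard, hsum, hprod] at hpow
  have hcoeff := congrArg (coeff m) hpow
  rw [coeff_sum_C_mul_X_pow, ← map_natCast C, coeff_C_mul, mul_comm (map φ _), coeff_C_mul,
    coeff_map] at hcoeff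
  have hmul := congrArg (fun n : ℕ => (n : A)) (Nat.multinomial_spec Finset.univ m)
  push_cast at hmul
  have hfac : φ ((((∑ p, m p).factorial : ℚ))⁻¹) * ((∑ p, m p).factorial : A) = 1 := by
    rw [← map_natCast φ, ← map_mul, inv_mul_cancel₀ (by positivity), map_one]
  rw [map_mul, map_prod]
  simp only [map_natCast]
  set N : A := ((∑ p, m p).factorial : A)
  set f : A := ∏ p, ((m p).factorial : A)
  linear_combination φ ((((∑ p, m p).factorial : ℚ))⁻¹) * f * hcoeff
    - φ ((((∑ p, m p).factorial : ℚ))⁻¹) * (∏ p, (∑ s, ω p.1 p.2 s) ^ m p) * hmul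
    + (f * φ (coeff m (detX k ^ l)) * (∏ s, ∏ i, ω i i s)
      - ∏ p, (∑ s, ω p.1 p.2 s) ^ m p) * hfac

open MvPolynomial in
theorem finsum_magic_eq (k l : ℕ) :
    (∑ᶠ (M : Matrix (Fin k) (Fin k) ℕ) (_ : IsMagic k l M),
        (∏ a, ∏ b, ((M a b).factorial : ℚ)) * (mulCoeff k l M) ^ 2) =
      ∑ m ∈ (detX k ^ l).support,
        (∏ p, ((m p).factorial : ℚ)) * (coeff m (detX k ^ l)) ^ 2 := by
  classical
  let e : (Fin k × Fin k →₀ ℕ) ≃ Matrix (Fin k) (Fin k) ℕ :=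
    Finsupp.equivFunOnFinite.trans (Equiv.curry _ _ _)
  rw [← finsum_comp_equiv e, ← finsum_mem_coe_finset]
  refine finsum_congr fun m => ?_
  have hcoeff : mulCoeff k l (e m) = coeff m (detX k ^ l) := by
    rw [mulCoeff]
    congr 1
    ext p
    rfl
  have hfac : (∏ a, ∏ b, ((e m a b).factorial : ℚ)) = ∏ p, ((m p).factorial : ℚ) := by
    rw [Fintype.prod_prod_type]
    rfl
  rw [hcoeff, hfac]
  by_cases hm : coeff m (detX k ^ l) = 0
  · simp [hm]
  · rw [finsum_eq_if, finsum_eq_if, if_pos (show IsMagic k l (e m) from isMagic_of_coeff_detX_pow_ne_zero hm),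
      if_pos (by simpa using hm)]

open MvPolynomial in
theorem det_sum_pow_eq (φ : ℚ →+* A) {k l : ℕ} (ω : Fin k → Fin k → Fin l → A)
    (h : ∀ s i j i' j', ω i j s * ω i' j' s = -(ω i j' s * ω i' j s)) :
    (Matrix.det (Matrix.of fun i j => ∑ s, ω i j s)) ^ l =
      φ (∑ᶠ (M : Matrix (Fin k) (Fin k) ℕ) (_ : IsMagic k l M),
        (∏ a, ∏ b, ((M a b).factorial : ℚ)) * (mulCoeff k l M) ^ 2) *
        ∏ s, ∏ i, ω i i s := by
  rw [finsum_magic_eq, ← map_detX φ, ← map_pow, coe_eval₂Hom, eval₂_eq', map_sum, Finset.sum_mul]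
  refine Finset.sum_congr rfl fun m hm => ?_
  have hmagic := (isMagic_of_coeff_detX_pow_ne_zero (mem_support_iff.1 hm)).1
  have hdeg : ∑ p, m p = l * k := by
    rw [Fintype.sum_prod_type, Finset.sum_congr rfl fun a _ => hmagic a]
    simp [mul_comm]
  simp only [Matrix.of_apply]
  rw [prod_sum_pow_eq φ ω h m hdeg, ← mul_assoc, ← map_mul]
  congr 2
  ring

end CommRing

section Exterior

open ExteriorAlgebra

variable {R M : Type*} [CommRing R] [AddCommGroup M] [Module R M]

theorem ι_mul_ι_eq_neg (x y : M) : ι R x * ι R y = -(ι R y * ι R x) :=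
  eq_neg_of_add_eq_zero_left (ι_add_mul_swap x y)

theorem ι_mul_ι_mul_exchange (a b c d : M) :
    (ι R a * ι R b) * (ι R c * ι R d) = -((ι R a * ι R d) * (ι R c * ι R b)) := by
  have h : ι R b * (ι R c * ι R d) = -(ι R d * (ι R c * ι R b)) := by
    rw [ι_mul_ι_eq_neg c d, ι_mul_ι_eq_neg c b, mul_neg, mul_neg, ← mul_assoc, ← mul_assoc,
      ι_mul_ι_eq_neg b d, neg_mul]
  rw [mul_assoc, h, mul_neg, mul_assoc]

theorem ι_mul_ι_commute (a b c d : M) : Commute (ι R a * ι R b) (ι R c * ι R d) := by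
  have h : ∀ x : M, ι R x * (ι R c * ι R d) = (ι R c * ι R d) * ι R x := by
    intro x
    rw [← mul_assoc, ι_mul_ι_eq_neg x c, neg_mul, mul_assoc, ι_mul_ι_eq_neg x d, mul_neg,
      neg_neg, mul_assoc]
  rw [commute_iff_eq, mul_assoc, h b, ← mul_assoc, h a, mul_assoc]

end Exterior

/-- In the exterior algebra, `det(Ω)^l = C · ∏_{s,i} ψ^i_s ∧ ψ̄^i_s` with
`C = Σ_{M ∈ 𝓜_{l,k}} (∏_{a,b} m_{a,b}!) · mul(M)²`. -/
theorem detOmega_pow_eq_magic_sum_smul_topProd (k l : ℕ) (hk : 0 < k) (hl : 0 < l) :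
    detOmega k l ^ l =
      (((∑ᶠ (M : Matrix (Fin k) (Fin k) ℕ) (_ : IsMagic k l M),
        (∏ a, ∏ b, ((M a b).factorial : ℚ)) * (mulCoeff k l M) ^ 2) : ℚ) : ℝ) •
        topProd k l := by
  let S : Set (Lam k l) :=
    Set.range fun p : (Fin k × Fin k) × Fin l => psi k l p.1.1 p.2 * psibar k l p.1.2 p.2
  have hcomm : ∀ x ∈ S, ∀ y ∈ S, x * y = y * x := by
    rintro _ ⟨p, rfl⟩ _ ⟨q, rfl⟩
    exact ι_mul_ι_commute _ _ _ _
  have : IsMulCommutative (Algebra.adjoin ℝ S) := Algebra.isMulCommutative_adjoin ℝ hcomm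
  let _ : CommRing (Algebra.adjoin ℝ S) := open scoped IsMulCommutative in inferInstance
  let ω : Fin k → Fin k → Fin l → Algebra.adjoin ℝ S := fun i j s =>
    ⟨psi k l i s * psibar k l j s, Algebra.subset_adjoin ⟨((i, j), s), rfl⟩⟩
  let φ : ℚ →+* Algebra.adjoin ℝ S := (algebraMap ℝ (Algebra.adjoin ℝ S)).comp (Rat.castHom ℝ)
  let v : Algebra.adjoin ℝ S →+* Lam k l := (Algebra.adjoin ℝ S).val.toRingHom
  have hω : ∀ i j s, v (ω i j s) = psi k l i s * psibar k l j s := fun i j s => rfl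
  have key := congrArg v (det_sum_pow_eq φ ω fun s i j i' j' =>
    Subtype.ext (ι_mul_ι_mul_exchange _ _ _ _))
  have hφ : ∀ q : ℚ, v (φ q) = algebraMap ℝ (Lam k l) (q : ℝ) := fun q => rfl
  have hdet : v (Matrix.det (Matrix.of fun i j => ∑ s, ω i j s)) = detOmega k l := by
    rw [← Matrix.det_transpose, Matrix.det_apply', map_sum, detOmega]
    refine Finset.sum_congr rfl fun σ _ => ?_
    rw [map_mul, map_intCast, ← zsmul_eq_mul, ← List.prod_ofFn, map_list_prod, List.map_ofFn]
    congr 3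
    ext a
    simp [Omega, hω]
  have htop : v (∏ s, ∏ i, ω i i s) = topProd k l := by
    rw [topProd, ← List.prod_ofFn, map_list_prod, List.map_ofFn]
    congr 2
    ext s
    rw [Function.comp_apply, ← List.prod_ofFn, map_list_prod, List.map_ofFn]
    rfl
  rw [map_pow, map_mul, hdet, htop, hφ] at key
  rw [key, Algebra.smul_def]
end

section
/- Let k≥1 and l≥0 be integers and let X=(x_{a,b}) be a k×k matrix of commuting indeterminates over ℚ. Then Σ_{σ∈S_k} sgn(σ) (∏_{a=1}^{k} ∂/∂x_{a,σ(a)}) det(X)^{l+1} = ((k+l)!/l!) · det(X)^l, as an identity of polynomials in the x_{a,b}. -/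
open scoped BigOperators

open Matrix in
/-- Exchange identity: trading row `j` of `A` with each row of `B` in turn. -/
theorem Matrix.sum_det_updateRow_mul_det_updateRow {n R : Type*} [Fintype n] [DecidableEq n]
    [CommRing R] (A B : Matrix n n R) (j : n) :
    ∑ i, (A.updateRow j (B i)).det * (B.updateRow i (A j)).det = A.det * B.det := by
  have h : ∑ i, (B.updateRow i (A j)).det • B i = B.det • A j := by
    have := mulVec_cramer Bᵀ (A j)
    rw [det_transpose] at this
    rw [← this]
    ext c
    simp [mulVec, dotProduct, cramer_transpose_apply, mul_comm]
  have h' := congrArg (fun v => cramer Aᵀ v j) h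
  simp only [map_sum, map_smul, Finset.sum_apply, Pi.smul_apply, smul_eq_mul] at h'
  simp only [cramer_transpose_apply, updateRow_eq_self] at h'
  rw [mul_comm A.det, ← h']
  exact Finset.sum_congr rfl fun i _ => mul_comm _ _

theorem Derivation.map_prod_eq_zero {ι R A : Type*} [CommRing R] [CommRing A] [Algebra R A]
    (D : Derivation R A A) (s : Finset ι) (f : ι → A) (h : ∀ i ∈ s, D (f i) = 0) :
    D (∏ i ∈ s, f i) = 0 := by
  classical
  induction s using Finset.induction_on with
  | empty => simp
  | insert a s ha ih =>
    rw [Finset.prod_insert ha, D.leibniz, h a (Finset.mem_insert_self a s),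
      ih fun i hi => h i (Finset.mem_insert_of_mem hi)]
    simp

/-- A derivation which kills all rows but one acts on the determinant through that row. -/
theorem Derivation.map_det_of_row {n R A : Type*} [Fintype n] [DecidableEq n] [CommRing R]
    [CommRing A] [Algebra R A] (D : Derivation R A A) (M : Matrix n n A) (j : n)
    (h : ∀ i, i ≠ j → ∀ c, D (M i c) = 0) :
    D M.det = (M.updateRow j fun c => D (M j c)).det := by
  rw [← Matrix.det_transpose M, ← Matrix.det_transpose (M.updateRow _ _), Matrix.det_apply,
    Matrix.det_apply, map_sum]
  refine Finset.sum_congr rfl fun σ _ => ?_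
  rw [Units.smul_def, Units.smul_def, map_zsmul]
  congr 1
  simp only [Matrix.transpose_apply]
  rw [← Finset.mul_prod_erase _ _ (Finset.mem_univ j),
    ← Finset.mul_prod_erase _ _ (Finset.mem_univ j), D.leibniz,
    D.map_prod_eq_zero _ _ fun i hi => h i (Finset.ne_of_mem_erase hi) _, smul_zero, zero_add,
    Matrix.updateRow_self, smul_eq_mul, mul_comm]
  congr 1
  exact Finset.prod_congr rfl fun i hi => by
    rw [Matrix.updateRow_ne (Finset.ne_of_mem_erase hi)]

open MvPolynomial

/-- The generic matrix whose rows `i ∈ S` are replaced by the standard basis vectors `e_{τ i}`. -/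
noncomputable def basisRows {k : ℕ} (S : Finset (Fin k)) (τ : Fin k → Fin k) :
    Matrix (Fin k) (Fin k) (MvPolynomial (Fin k × Fin k) ℚ) :=
  Matrix.of fun i => if i ∈ S then Pi.single (τ i) 1 else fun c => X (i, c)

theorem basisRows_of_mem {k : ℕ} {S : Finset (Fin k)} {i : Fin k} (h : i ∈ S)
    (τ : Fin k → Fin k) : basisRows S τ i = Pi.single (τ i) 1 :=
  if_pos h

theorem basisRows_of_notMem {k : ℕ} {S : Finset (Fin k)} {i : Fin k} (h : i ∉ S)
    (τ : Fin k → Fin k) : basisRows S τ i = fun c => X (i, c) :=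
  if_neg h

theorem det_basisRows_empty {k : ℕ} (τ : Fin k → Fin k) : (basisRows ∅ τ).det = detX k := by
  rw [detX]
  congr 1

theorem det_basisRows_univ {k : ℕ} (σ : Equiv.Perm (Fin k)) :
    (basisRows Finset.univ σ).det = ((Equiv.Perm.sign σ : ℤ) : MvPolynomial _ ℚ) := by
  have : basisRows Finset.univ σ =
      (1 : Matrix (Fin k) (Fin k) (MvPolynomial (Fin k × Fin k) ℚ)).submatrix σ id := by
    refine funext fun i => ?_
    rw [basisRows_of_mem (Finset.mem_univ i)]
    ext1 c
    simp [Matrix.one_apply, Pi.single_apply, eq_comm]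
  rw [this, Matrix.det_permute, Matrix.det_one, mul_one]

theorem pderiv_det_basisRows {k : ℕ} {S : Finset (Fin k)} {j : Fin k} (hj : j ∉ S)
    (τ : Fin k → Fin k) (c : Fin k) :
    pderiv (j, c) (basisRows S τ).det =
      ((basisRows S τ).updateRow j (Pi.single c 1)).det := by
  rw [Derivation.map_det_of_row _ _ j]
  · congr 2
    ext1 d
    rw [basisRows_of_notMem hj, pderiv_X]
    by_cases h : d = c
    · simp [h]
    · rw [Pi.single_eq_of_ne h, Pi.single_eq_of_ne]
      simpa using h
  · intro i hi d
    by_cases h : i ∈ S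
    · rw [basisRows_of_mem h, Pi.single_apply]
      split_ifs <;> simp
    · rw [basisRows_of_notMem h]
      exact pderiv_X_of_ne (by simp [hi])

section Swap

variable {k : ℕ} {S : Finset (Fin k)} {j m : Fin k}

theorem swap_mem_insert_iff (hm : m ∈ insert j S) (i : Fin k) :
    Equiv.swap m j i ∈ insert j S ↔ i ∈ insert j S := by
  rw [Equiv.swap_apply_def]
  split_ifs with h1 h2
  · simp [h1, hm]
  · simp [h2, hm]
  · rfl

theorem updateRow_basisRows_swap (hm : m ∈ insert j S) (τ : Fin k → Fin k) :
    (basisRows S (τ ∘ Equiv.swap m j)).updateRow j (Pi.single (τ m) 1) =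
      (basisRows (insert j S) τ).submatrix (Equiv.swap m j) id := by
  refine funext fun i => ?_
  change _ = basisRows (insert j S) τ (Equiv.swap m j i)
  by_cases hi : i = j
  · subst hi
    rw [Matrix.updateRow_self, Equiv.swap_apply_right, basisRows_of_mem hm]
  rw [Matrix.updateRow_ne hi]
  by_cases hS : i ∈ S
  · rw [basisRows_of_mem hS,
      basisRows_of_mem ((swap_mem_insert_iff hm i).2 (Finset.mem_insert_of_mem hS))]
    rfl
  · have hi' : i ∉ insert j S := by simp [hi, hS]
    rw [basisRows_of_notMem hS, basisRows_of_notMem (mt (swap_mem_insert_iff hm i).1 hi'),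
      Equiv.swap_apply_of_ne_of_ne (fun h : i = m => hi' (h ▸ hm)) hi]

theorem basisRows_swap_eq (hj : j ∉ S) (hm : m ∈ insert j S) (τ : Fin k → Fin k) :
    basisRows S (τ ∘ Equiv.swap m j) =
      ((basisRows (insert j S) τ).updateRow m fun c => X (j, c)).submatrix
        (Equiv.swap m j) id := by
  refine funext fun i => ?_
  change _ = ((basisRows (insert j S) τ).updateRow m fun c => X (j, c)) (Equiv.swap m j i)
  by_cases hi : i = j
  · subst hi
    rw [Equiv.swap_apply_right, Matrix.updateRow_self, basisRows_of_notMem hj]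
  have hne : Equiv.swap m j i ≠ m := fun h =>
    hi ((Equiv.swap m j).injective (h.trans (Equiv.swap_apply_right m j).symm))
  rw [Matrix.updateRow_ne hne]
  have := congrFun (updateRow_basisRows_swap hm τ) i
  rwa [Matrix.updateRow_ne hi] at this

theorem sum_sign_swap_pderiv (l : ℕ) (hj : j ∉ S) (τ : Fin k → Fin k) :
    ∑ m ∈ insert j S, (((Equiv.Perm.sign (Equiv.swap m j) : ℤ) : ℚ) •
      pderiv (j, τ m) (detX k ^ l * (basisRows S (τ ∘ Equiv.swap m j)).det)) =
    ((l + S.card + 1 : ℕ) : ℚ) • (detX k ^ l * (basisRows (insert j S) τ).det) := by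
  set Z := basisRows (insert j S) τ with hZ
  set A : Matrix (Fin k) (Fin k) (MvPolynomial (Fin k × Fin k) ℚ) := basisRows ∅ τ with hA
  have hAj : A j = fun c => X (j, c) := basisRows_of_notMem (Finset.notMem_empty j) τ
  have hdA : A.det = detX k := det_basisRows_empty τ
  have sq (m : Fin k) : ((Equiv.Perm.sign (Equiv.swap m j) : ℤ) :
      MvPolynomial (Fin k × Fin k) ℚ) * ((Equiv.Perm.sign (Equiv.swap m j) : ℤ) :
      MvPolynomial (Fin k × Fin k) ℚ) = 1 := by
    rw [← Int.cast_mul, ← Units.val_mul, Int.units_mul_self]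
    simp
  have term (m : Fin k) (hm : m ∈ insert j S) :
      ((Equiv.Perm.sign (Equiv.swap m j) : ℤ) : ℚ) •
        pderiv (j, τ m) (detX k ^ l * (basisRows S (τ ∘ Equiv.swap m j)).det) =
      detX k ^ l * Z.det + (l : MvPolynomial (Fin k × Fin k) ℚ) * detX k ^ (l - 1) *
        ((A.updateRow j (Z m)).det * (Z.updateRow m (A j)).det) := by
    have h1 : pderiv (j, τ m) (detX k) = (A.updateRow j (Z m)).det := by
      rw [← hdA, hA, pderiv_det_basisRows (Finset.notMem_empty j), hZ, basisRows_of_mem hm]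
    rw [Derivation.leibniz, Derivation.leibniz_pow, pderiv_det_basisRows hj,
      updateRow_basisRows_swap hm, h1, basisRows_swap_eq hj hm, Matrix.det_permute,
      Matrix.det_permute, ← hAj, ← hZ, MvPolynomial.smul_eq_C_mul, map_intCast]
    simp only [smul_eq_mul, nsmul_eq_mul]
    linear_combination (detX k ^ l * Z.det + (l : MvPolynomial (Fin k × Fin k) ℚ) *
      detX k ^ (l - 1) * ((A.updateRow j (Z m)).det * (Z.updateRow m (A j)).det)) * sq m
  have exch : ∑ m ∈ insert j S, (A.updateRow j (Z m)).det * (Z.updateRow m (A j)).det =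
      detX k * Z.det := by
    rw [← hdA, ← Matrix.sum_det_updateRow_mul_det_updateRow A Z j]
    refine Finset.sum_subset (Finset.subset_univ _) fun m _ hm => ?_
    have hmj : m ≠ j := fun h => hm (h ▸ Finset.mem_insert_self j S)
    have : Z m = A m := by
      rw [hZ, hA, basisRows_of_notMem hm, basisRows_of_notMem (Finset.notMem_empty m)]
    rw [this, Matrix.det_updateRow_eq_zero hmj, zero_mul]
  rw [Finset.sum_congr rfl term, Finset.sum_add_distrib, ← Finset.mul_sum, ← Finset.mul_sum,
    exch, Finset.sum_const, Finset.card_insert_of_notMem hj, MvPolynomial.smul_eq_C_mul, map_natCast]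
  cases l with
  | zero => simp
  | succ l =>
    simp only [nsmul_eq_mul, Nat.add_sub_cancel]
    push_cast
    ring

end Swap

/-- The composition of the `∂/∂x_{a,τ a}` for `a` in a list, as a linear map. -/
noncomputable def pderivList {k : ℕ} (L : List (Fin k)) (τ : Fin k → Fin k) :
    MvPolynomial (Fin k × Fin k) ℚ →ₗ[ℚ] MvPolynomial (Fin k × Fin k) ℚ :=
  L.foldr (fun a f => (pderiv (a, τ a)).toLinearMap ∘ₗ f) LinearMap.id

theorem pderivList_cons {k : ℕ} (a : Fin k) (L : List (Fin k)) (τ : Fin k → Fin k)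
    (p : MvPolynomial (Fin k × Fin k) ℚ) :
    pderivList (a :: L) τ p = pderiv (a, τ a) (pderivList L τ p) := rfl

theorem pderivList_apply {k : ℕ} (L : List (Fin k)) (τ : Fin k → Fin k)
    (p : MvPolynomial (Fin k × Fin k) ℚ) :
    pderivList L τ p = (L.map fun a => (a, τ a)).foldr (fun idx p => pderiv idx p) p := by
  induction L with
  | nil => rfl
  | cons a L ih => rw [pderivList_cons, ih, List.map_cons, List.foldr_cons]

theorem pderivList_concat {k : ℕ} (L : List (Fin k)) (a : Fin k) (τ : Fin k → Fin k)
    (p : MvPolynomial (Fin k × Fin k) ℚ) :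
    pderivList (L ++ [a]) τ p = pderivList L τ (pderiv (a, τ a) p) := by
  simp [pderivList_apply]

theorem pderivList_congr {k : ℕ} {L : List (Fin k)} {τ τ' : Fin k → Fin k}
    (h : ∀ a ∈ L, τ a = τ' a) : pderivList L τ = pderivList L τ' := by
  refine LinearMap.ext fun p => ?_
  rw [pderivList_apply, pderivList_apply]
  congr 1
  exact List.map_congr_left fun a ha => by rw [h a ha]

theorem sum_sign_pderivList_concat {k : ℕ} (l : ℕ) {S : Finset (Fin k)} {j : Fin k}
    {L : List (Fin k)} (hj : j ∉ S) (hL : ∀ a ∈ L, a ∉ insert j S) :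
    ((S.card + 1 : ℕ) : ℚ) • ∑ σ : Equiv.Perm (Fin k), ((Equiv.Perm.sign σ : ℤ) : ℚ) •
      pderivList (L ++ [j]) σ (detX k ^ l * (basisRows S σ).det) =
    ((l + S.card + 1 : ℕ) : ℚ) • ∑ σ : Equiv.Perm (Fin k), ((Equiv.Perm.sign σ : ℤ) : ℚ) •
      pderivList L σ (detX k ^ l * (basisRows (insert j S) σ).det) := by
  have reindex (m : Fin k) (hm : m ∈ insert j S) :
      ∑ σ : Equiv.Perm (Fin k), ((Equiv.Perm.sign σ : ℤ) : ℚ) •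
        pderivList (L ++ [j]) σ (detX k ^ l * (basisRows S σ).det) =
      ∑ σ : Equiv.Perm (Fin k), ((Equiv.Perm.sign σ : ℤ) : ℚ) • pderivList L σ
        (((Equiv.Perm.sign (Equiv.swap m j) : ℤ) : ℚ) •
          pderiv (j, σ m) (detX k ^ l * (basisRows S (σ ∘ Equiv.swap m j)).det)) := by
    rw [← Equiv.sum_comp (Equiv.mulRight (Equiv.swap m j))]
    refine Finset.sum_congr rfl fun σ _ => ?_
    have hcongr : pderivList L (σ * Equiv.swap m j : Equiv.Perm (Fin k)) = pderivList L σ :=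
      pderivList_congr fun a ha => by
        rw [Equiv.Perm.mul_apply, Equiv.swap_apply_of_ne_of_ne]
        · exact fun h => hL a ha (h ▸ hm)
        · exact fun h => hL a ha (h ▸ Finset.mem_insert_self j S)
    rw [Equiv.coe_mulRight, pderivList_concat, hcongr, map_smul, smul_smul,
      Equiv.Perm.sign_mul, Units.val_mul, Int.cast_mul, Equiv.Perm.mul_apply,
      Equiv.swap_apply_right, Equiv.Perm.coe_mul]
  rw [← Finset.card_insert_of_notMem hj, Nat.cast_smul_eq_nsmul, ← Finset.sum_const,
    Finset.sum_congr rfl reindex, Finset.sum_comm, Finset.smul_sum]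
  refine Finset.sum_congr rfl fun σ _ => ?_
  rw [← Finset.smul_sum, ← map_sum, sum_sign_swap_pderiv l hj, map_smul, smul_comm]

theorem sum_sign_pderivList {k : ℕ} (l : ℕ) (L : List (Fin k)) :
    ∀ S : Finset (Fin k), L.Nodup → (∀ a, a ∈ L ↔ a ∉ S) →
    ((l + S.card).factorial : ℚ) • ∑ σ : Equiv.Perm (Fin k), ((Equiv.Perm.sign σ : ℤ) : ℚ) •
      pderivList L σ (detX k ^ l * (basisRows S σ).det) =
    (((l + k).factorial : ℚ) * (S.card.factorial : ℚ)) • detX k ^ l := by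
  induction L using List.reverseRecOn with
  | nil =>
    intro S _ hS
    obtain rfl : S = Finset.univ := Finset.eq_univ_iff_forall.2 fun a => by simpa using hS a
    have term (σ : Equiv.Perm (Fin k)) : ((Equiv.Perm.sign σ : ℤ) : ℚ) •
        pderivList [] σ (detX k ^ l * (basisRows Finset.univ σ).det) = detX k ^ l := by
      change _ • (detX k ^ l * (basisRows Finset.univ σ).det) = _
      rw [det_basisRows_univ, MvPolynomial.smul_eq_C_mul, map_intCast, mul_left_comm,
        ← Int.cast_mul, ← Units.val_mul, Int.units_mul_self]
      simp
    rw [Finset.sum_congr rfl fun σ _ => term σ, Finset.sum_const, Finset.card_univ,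
      Finset.card_univ, Fintype.card_perm, Fintype.card_fin, ← Nat.cast_smul_eq_nsmul ℚ,
      smul_smul]
  | append_singleton L j ih =>
    intro S hnd hS
    have hj : j ∉ S := (hS j).1 (by simp)
    have hjL : j ∉ L := fun h => (List.disjoint_of_nodup_append hnd) h (by simp)
    have hS' (a : Fin k) : a ∈ L ↔ a ∉ insert j S := by
      have := hS a
      by_cases h : a = j
      · simp [h, hjL]
      · simpa [h] using this
    have step := sum_sign_pderivList_concat l hj fun a ha => (hS' a).1 ha
    have hind := ih (insert j S) hnd.of_append_left hS'
    rw [Finset.card_insert_of_notMem hj] at hind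
    have hne : ((S.card + 1 : ℕ) : ℚ) ≠ 0 := by positivity
    refine smul_right_injective _ hne ?_
    change _ • _ • _ = _ • _ • _
    rw [smul_comm, step, smul_smul, smul_smul]
    rw [← Nat.add_assoc, Nat.factorial_succ, Nat.factorial_succ] at hind
    convert hind using 2
    · push_cast; ring
    · push_cast; ring

/-- `Σ_{σ ∈ S_k} sgn(σ) (∏_{a=1}^{k} ∂/∂x_{a,σ(a)}) det(X)^{l+1} = ((k+l)!/l!) det(X)^l`. -/
theorem sum_sign_pderiv_detX_pow_succ (k l : ℕ) (hk : 0 < k) :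
    (∑ σ : Equiv.Perm (Fin k),
      ((Equiv.Perm.sign σ : ℤ) : ℚ) •
        ((List.ofFn fun a : Fin k => ((a, σ a) : Fin k × Fin k)).foldr
          (fun idx p => MvPolynomial.pderiv idx p) (detX k ^ (l + 1)))) =
      (((k + l).factorial : ℚ) / (l.factorial : ℚ)) • (detX k ^ l) := by
  have h := sum_sign_pderivList l (List.finRange k) ∅ (List.nodup_finRange k) (by simp)
  simp only [Finset.card_empty, add_zero, Nat.factorial_zero, Nat.cast_one, mul_one,
    det_basisRows_empty, ← pow_succ, pderivList_apply, ← List.ofFn_eq_map] at h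
  have hl : (l.factorial : ℚ) ≠ 0 := by positivity
  rw [div_eq_inv_mul, mul_smul, add_comm k l, ← h, smul_smul, inv_mul_cancel₀ hl, one_smul]
end

section
/- Let k and l be positive integers and let M=(m_{a,b}) be a k×k matrix of nonnegative integers with all row sums and column sums equal to l. Then Σ_{σ,τ∈S_k} (∏_{a=1}^{k} (m_{a,σ(a)}+1)) · sgn(σ) · sgn(τ) · mul(M + R(σ) − R(τ)) = ((k+l)!/l!) · mul(M), where mul(M + R(σ) − R(τ)) is set to 0 whenever M + R(σ) − R(τ) has a negative entry. -/
open scoped BigOperators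

open MvPolynomial

section Derivation

variable {R A : Type*} [CommRing R] [CommRing A] [Algebra R A]

theorem Derivation.map_finset_prod {ι : Type*} [DecidableEq ι] (δ : Derivation R A A)
    (s : Finset ι) (f : ι → A) :
    δ (∏ i ∈ s, f i) = ∑ i ∈ s, ∏ j ∈ s, (if j = i then δ (f j) else f j) := by
  induction s using Finset.induction_on with
  | empty => simp
  | insert a s ha ih =>
    rw [Finset.prod_insert ha, Derivation.leibniz, ih, Finset.sum_insert ha,
      Finset.prod_insert ha, if_pos rfl, smul_eq_mul, smul_eq_mul, add_comm, Finset.mul_sum]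
    congr 1
    · rw [mul_comm]
      congr 1
      refine Finset.prod_congr rfl fun j hj => ?_
      rw [if_neg (by rintro rfl; exact ha hj)]
    · refine Finset.sum_congr rfl fun i hi => ?_
      rw [Finset.prod_insert ha, if_neg (by rintro rfl; exact ha hi)]

theorem Derivation.map_det {n : Type*} [Fintype n] [DecidableEq n] (δ : Derivation R A A)
    (N : Matrix n n A) :
    δ N.det = ∑ i, (N.updateRow i fun j => δ (N i j)).det := by
  have key : ∀ N' : Matrix n n A,
      N'.det = ∑ σ : Equiv.Perm n, ((Equiv.Perm.sign σ : ℤ) : A) * ∏ i, N' i (σ i) := by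
    intro N'
    rw [← Matrix.det_transpose, Matrix.det_apply']
    rfl
  simp only [key]
  rw [map_sum, Finset.sum_comm]
  refine Finset.sum_congr rfl fun σ _ => ?_
  rw [Derivation.leibniz, Derivation.map_intCast, smul_zero, add_zero, smul_eq_mul,
    Derivation.map_finset_prod, Finset.mul_sum]
  refine Finset.sum_congr rfl fun i _ => ?_
  congr 1
  refine Finset.prod_congr rfl fun j _ => ?_
  rw [Matrix.updateRow_apply]
  split_ifs with h
  · rw [h]
  · rfl

end Derivation

section Cayley

variable {k : ℕ}

theorem pderiv_detX (p : Fin k × Fin k) :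
    pderiv p (detX k) = (Matrix.of fun a b : Fin k =>
      (X (a, b) : MvPolynomial (Fin k × Fin k) ℚ)).adjugate p.2 p.1 := by
  rw [detX, Derivation.map_det, Finset.sum_eq_single p.1, Matrix.adjugate_apply]
  · congr 2
    ext j
    rw [Matrix.of_apply, pderiv_X]
    by_cases h : p.2 = j
    · subst h; simp
    · rw [Pi.single_eq_of_ne, Pi.single_eq_of_ne (Ne.symm h)]
      rintro h'
      exact h (by rw [← h'])
  · intro i _ hi
    refine Matrix.det_eq_zero_of_row_eq_zero i fun j => ?_
    rw [Matrix.updateRow_self, Matrix.of_apply, pderiv_X_of_ne]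
    rintro rfl
    exact hi rfl
  · simp

/-- The cofactor matrix of the generic matrix. -/
noncomputable def cofactorX (k : ℕ) : Matrix (Fin k) (Fin k) (MvPolynomial (Fin k × Fin k) ℚ) :=
  Matrix.of fun a b => pderiv (a, b) (detX k)

theorem cofactorX_apply (a b : Fin k) : cofactorX k a b = pderiv (a, b) (detX k) := rfl

theorem cofactorX_eq : cofactorX k = (Matrix.of fun a b : Fin k =>
    (X (a, b) : MvPolynomial (Fin k × Fin k) ℚ)).adjugate.transpose := by
  ext1 a b
  rw [cofactorX_apply, pderiv_detX, Matrix.transpose_apply]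

theorem detX_mul_pderiv_cofactorX (a b c d : Fin k) :
    detX k * pderiv (a, b) (cofactorX k c d) =
      cofactorX k a b * cofactorX k c d - cofactorX k a d * cofactorX k c b := by
  have h1 : ∀ e, ∑ f, X (e, f) * cofactorX k c f = if e = c then detX k else 0 := by
    intro e
    have := congrFun (congrFun (Matrix.mul_adjugate (Matrix.of fun a b : Fin k =>
      (X (a, b) : MvPolynomial (Fin k × Fin k) ℚ))) e) c
    rw [Matrix.mul_apply] at this
    simp only [cofactorX_eq, Matrix.transpose_apply]
    simpa [Matrix.one_apply, detX] using this
  have h2 : ∀ g, ∑ e, cofactorX k e d * X (e, g) = if d = g then detX k else 0 := by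
    intro g
    have := congrFun (congrFun (Matrix.adjugate_mul (Matrix.of fun a b : Fin k =>
      (X (a, b) : MvPolynomial (Fin k × Fin k) ℚ))) d) g
    rw [Matrix.mul_apply] at this
    simp only [cofactorX_eq, Matrix.transpose_apply]
    simpa [Matrix.one_apply, detX] using this
  have h3 : ∀ e, ∑ f, X (e, f) * pderiv (a, b) (cofactorX k c f) =
      (if e = c then cofactorX k a b else 0) - (if e = a then cofactorX k c b else 0) := by
    intro e
    have h := congrArg (pderiv (a, b)) (h1 e)
    rw [map_sum] at h
    simp only [pderiv_mul, Finset.sum_add_distrib] at h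
    have e1 : ∑ f, pderiv (a, b) (X (e, f)) * cofactorX k c f =
        if e = a then cofactorX k c b else 0 := by
      simp only [pderiv_X]
      by_cases he : e = a
      · subst he
        rw [Finset.sum_eq_single b] <;> simp +contextual
      · simp [he]
    rw [e1] at h
    rw [eq_sub_iff_add_eq, add_comm, h]
    split_ifs <;> simp [cofactorX_apply]
  have h4 : ∑ e, cofactorX k e d * ∑ f, X (e, f) * pderiv (a, b) (cofactorX k c f) =
      detX k * pderiv (a, b) (cofactorX k c d) := by
    simp only [Finset.mul_sum]
    rw [Finset.sum_comm]
    simp only [← mul_assoc, ← Finset.sum_mul, h2]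
    simp
  rw [← h4]
  simp only [h3, mul_sub, Finset.sum_sub_distrib]
  simp [mul_comm]

theorem detX_mul_pderiv_det_cofactorX {r : ℕ} (p q : Fin k) (a b : Fin r → Fin k) :
    detX k * pderiv (p, q) ((cofactorX k).submatrix a b).det =
      r * (cofactorX k p q * ((cofactorX k).submatrix a b).det) -
        ∑ i, cofactorX k (a i) q *
          (((cofactorX k).submatrix a b).updateRow i fun j => cofactorX k p (b j)).det := by
  set N := (cofactorX k).submatrix a b with hN
  rw [Derivation.map_det, Finset.mul_sum]
  have : ∀ i, detX k * (N.updateRow i fun j => pderiv (p, q) (N i j)).det =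
      cofactorX k p q * N.det -
        cofactorX k (a i) q * (N.updateRow i fun j => cofactorX k p (b j)).det := by
    intro i
    rw [← Matrix.det_updateRow_smul]
    have e : (detX k • fun j => pderiv (p, q) (N i j)) =
        cofactorX k p q • N i + (-cofactorX k (a i) q) • fun j => cofactorX k p (b j) := by
      ext1 j
      simp only [Pi.smul_apply, Pi.add_apply, smul_eq_mul, hN, Matrix.submatrix_apply,
        detX_mul_pderiv_cofactorX]
      ring
    rw [e, Matrix.det_updateRow_add, Matrix.det_updateRow_smul, Matrix.det_updateRow_smul,
      Matrix.updateRow_eq_self]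
    ring
  rw [Finset.sum_congr rfl fun i _ => this i, Finset.sum_sub_distrib]
  simp

theorem exists_commRing_pderiv (σ R : Type) [CommRing R] :
    ∃ (A : Type) (_ : CommRing A) (φ : A →+* Module.End R (MvPolynomial σ R)) (d : σ → A),
      ∀ p f, φ (d p) f = pderiv p f := by
  classical
  let S : Set (Module.End R (MvPolynomial σ R)) := Set.range fun p => (pderiv p).toLinearMap
  have hS : ∀ x ∈ S, ∀ y ∈ S, x * y = y * x := by
    rintro _ ⟨p, rfl⟩ _ ⟨q, rfl⟩
    refine LinearMap.ext fun f => ?_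
    have h : ⁅(pderiv p : Derivation R (MvPolynomial σ R) (MvPolynomial σ R)),
        (pderiv q : Derivation R (MvPolynomial σ R) (MvPolynomial σ R))⁆ = 0 := by
      refine MvPolynomial.derivation_ext fun i => ?_
      rw [Derivation.commutator_apply]
      simp only [pderiv_X, Pi.single_apply]
      split_ifs <;> simp
    have h' := Derivation.congr_fun h f
    rw [Derivation.commutator_apply] at h'
    exact sub_eq_zero.mp h'
  have := Algebra.isMulCommutative_adjoin R hS
  refine ⟨Algebra.adjoin R S,
    { (inferInstance : Ring (Algebra.adjoin R S)) with mul_comm := this.is_comm.comm },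
    (Algebra.adjoin R S).val.toRingHom,
    fun p => ⟨(pderiv p).toLinearMap, Algebra.subset_adjoin ⟨p, rfl⟩⟩, fun p f => rfl⟩

variable {A : Type} [CommRing A]
  (φ : A →+* Module.End ℚ (MvPolynomial (Fin k × Fin k) ℚ)) (d : Fin k × Fin k → A)

/-- Cayley's identity for minors of the matrix of partial derivatives. -/
theorem detX_pow_mul_det_pderiv_apply (hd : ∀ p f, φ (d p) f = pderiv p f) (s r : ℕ)
    (a b : Fin r → Fin k) :
    detX k ^ r * φ (Matrix.of fun i j => d (a i, b j)).det (detX k ^ s) =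
      (s.ascFactorial r : MvPolynomial (Fin k × Fin k) ℚ) *
        (detX k ^ s * ((cofactorX k).submatrix a b).det) := by
  induction r with
  | zero => simp
  | succ r ih =>
    have step : ∀ j : Fin (r + 1), detX k ^ (r + 1) * pderiv (a 0, b j)
        (φ (Matrix.of fun i l => d (a (Fin.succ i), b (j.succAbove l))).det (detX k ^ s)) =
        (s.ascFactorial r : MvPolynomial (Fin k × Fin k) ℚ) * detX k ^ s *
          (s * (cofactorX k (a 0) (b j) *
            ((cofactorX k).submatrix (a ∘ Fin.succ) (b ∘ j.succAbove)).det) -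
          ∑ i : Fin r, cofactorX k (a i.succ) (b j) *
            (((cofactorX k).submatrix (a ∘ Fin.succ) (b ∘ j.succAbove)).updateRow i
              fun l => cofactorX k (a 0) (b (j.succAbove l))).det) := by
      intro j
      have hj := ih (a ∘ Fin.succ) (b ∘ j.succAbove)
      have hB := detX_mul_pderiv_det_cofactorX (a 0) (b j) (a ∘ Fin.succ) (b ∘ j.succAbove)
      simp only [Function.comp_apply] at hj hB
      set G := φ (Matrix.of fun i l => d (a (Fin.succ i), b (j.succAbove l))).det (detX k ^ s)
      set B := ((cofactorX k).submatrix (a ∘ Fin.succ) (b ∘ j.succAbove)).det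
      have hpow : ∀ n : ℕ, detX k * pderiv (a 0, b j) (detX k ^ n) =
          n * (detX k ^ n * cofactorX k (a 0) (b j)) := by
        intro n
        rw [Derivation.leibniz_pow, cofactorX_apply]
        cases n with
        | zero => simp
        | succ n => simp [pow_succ]; ring
      have hdiff := congrArg (fun f => detX k * pderiv (a 0, b j) f) hj
      simp only [pderiv_mul, Derivation.map_natCast] at hdiff
      linear_combination hdiff - G * hpow r
        + s.ascFactorial r * B * hpow s
        - r * cofactorX k (a 0) (b j) * hj
        + s.ascFactorial r * detX k ^ s * hB
    have swap_sum : ∀ i : Fin r, ∑ j : Fin (r + 1), (-1) ^ (j : ℕ) *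
        (cofactorX k (a i.succ) (b j) *
          (((cofactorX k).submatrix (a ∘ Fin.succ) (b ∘ j.succAbove)).updateRow i
            fun l => cofactorX k (a 0) (b (j.succAbove l))).det) =
        -((cofactorX k).submatrix a b).det := by
      intro i
      have h0 := Matrix.det_permute (Equiv.swap 0 i.succ) ((cofactorX k).submatrix a b)
      rw [Equiv.Perm.sign_swap (Fin.succ_ne_zero i).symm, Matrix.det_succ_row_zero] at h0
      simp only [Units.val_neg, Units.val_one, Int.cast_neg, Int.cast_one, neg_mul, one_mul] at h0
      rw [← h0]
      refine Finset.sum_congr rfl fun j _ => ?_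
      rw [← mul_assoc]
      refine congrArg₂ (· * ·) ?_ ?_
      · simp
      · refine congrArg Matrix.det ?_
        ext1 i' l
        rw [Matrix.updateRow_apply]
        split_ifs with h
        · subst h; simp
        · have : Equiv.swap 0 i.succ i'.succ = i'.succ :=
            Equiv.swap_apply_of_ne_of_ne (Fin.succ_ne_zero _)
              fun h' => h (Fin.succ_injective _ h')
          simp [this]
    have lap : ∑ j : Fin (r + 1), (-1) ^ (j : ℕ) * (cofactorX k (a 0) (b j) *
        ((cofactorX k).submatrix (a ∘ Fin.succ) (b ∘ j.succAbove)).det) =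
        ((cofactorX k).submatrix a b).det := by
      rw [Matrix.det_succ_row_zero ((cofactorX k).submatrix a b)]
      refine Finset.sum_congr rfl fun j _ => ?_
      rw [← mul_assoc]
      rfl
    have expand : φ (Matrix.of fun i j => d (a i, b j)).det (detX k ^ s) =
        ∑ j : Fin (r + 1), (-1) ^ (j : ℕ) * pderiv (a 0, b j)
          (φ (Matrix.of fun i l => d (a (Fin.succ i), b (j.succAbove l))).det (detX k ^ s)) := by
      rw [Matrix.det_succ_row_zero, map_sum, LinearMap.sum_apply]
      refine Finset.sum_congr rfl fun j _ => ?_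
      have hsign : ∀ g, φ ((-1) ^ (j : ℕ)) g = (-1) ^ (j : ℕ) * g := by
        intro g
        rcases Nat.even_or_odd (j : ℕ) with h | h <;> simp [h.neg_one_pow]
      rw [mul_assoc, map_mul, map_mul, Module.End.mul_apply, Module.End.mul_apply, hsign]
      change _ * φ (d (a 0, b j)) _ = _
      rw [hd]
      rfl
    rw [expand, Finset.mul_sum]
    simp only [mul_left_comm (detX k ^ (r + 1)), step]
    calc
      _ = (s.ascFactorial r : MvPolynomial (Fin k × Fin k) ℚ) * detX k ^ s *
          (s * (∑ j : Fin (r + 1), (-1) ^ (j : ℕ) * (cofactorX k (a 0) (b j) *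
            ((cofactorX k).submatrix (a ∘ Fin.succ) (b ∘ j.succAbove)).det)) -
          ∑ i : Fin r, ∑ j : Fin (r + 1), (-1) ^ (j : ℕ) *
            (cofactorX k (a i.succ) (b j) *
              (((cofactorX k).submatrix (a ∘ Fin.succ) (b ∘ j.succAbove)).updateRow i
                fun l => cofactorX k (a 0) (b (j.succAbove l))).det)) := by
        rw [Finset.sum_comm, Finset.mul_sum, ← Finset.sum_sub_distrib, Finset.mul_sum]
        refine Finset.sum_congr rfl fun j _ => ?_
        rw [← Finset.mul_sum]
        ring
      _ = _ := by
        rw [lap, Finset.sum_congr rfl fun i _ => swap_sum i, Nat.ascFactorial_succ]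
        simp
        ring

theorem detX_ne_zero : detX k ≠ 0 :=
  Matrix.det_mvPolynomialX_ne_zero (Fin k) ℚ

/-- Cayley's identity. -/
theorem det_pderiv_apply_detX_pow (hk : 0 < k) (hd : ∀ p f, φ (d p) f = pderiv p f) (l : ℕ) :
    φ (Matrix.of fun i j => d (i, j)).det (detX k ^ (l + 1)) =
      ((l + 1).ascFactorial k : MvPolynomial (Fin k × Fin k) ℚ) * detX k ^ l := by
  have h := detX_pow_mul_det_pderiv_apply φ d hd (l + 1) k id id
  rw [Matrix.submatrix_id_id, cofactorX_eq, Matrix.det_transpose, Matrix.det_adjugate,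
    Fintype.card_fin] at h
  refine mul_left_cancel₀ (pow_ne_zero k (detX_ne_zero (k := k))) ?_
  refine h.trans ?_
  change _ * (_ * detX k ^ (k - 1)) = _
  obtain ⟨n, rfl⟩ := Nat.exists_eq_succ_of_ne_zero hk.ne'
  simp only [Nat.succ_eq_add_one, Nat.add_sub_cancel]
  ring

theorem coeff_prod_pderiv_apply (hd : ∀ p f, φ (d p) f = pderiv p f) (σ : Fin k → Fin k)
    (s : Finset (Fin k)) (f : MvPolynomial (Fin k × Fin k) ℚ) (m : Fin k × Fin k →₀ ℕ) :
    coeff m (φ (∏ i ∈ s, d (i, σ i)) f) =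
      (∏ i ∈ s, ((m (i, σ i) : ℚ) + 1)) *
        coeff (m + ∑ i ∈ s, Finsupp.single (i, σ i) 1) f := by
  induction s using Finset.induction_on generalizing m with
  | empty => simp
  | insert a s ha ih =>
    rw [Finset.prod_insert ha, Finset.prod_insert ha, Finset.sum_insert ha, map_mul,
      Module.End.mul_apply, hd, coeff_pderiv, ih, ← add_assoc]
    have : ∏ i ∈ s, (((m + Finsupp.single (a, σ a) 1 : Fin k × Fin k →₀ ℕ) (i, σ i) : ℚ) + 1) =
        ∏ i ∈ s, ((m (i, σ i) : ℚ) + 1) := by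
      refine Finset.prod_congr rfl fun i hi => ?_
      rw [Finsupp.add_apply, Finsupp.single_eq_of_ne, add_zero]
      rintro h
      apply ha
      exact (Prod.mk.inj h).1 ▸ hi
    rw [this]
    ring

theorem coeff_det_pderiv_apply (hd : ∀ p f, φ (d p) f = pderiv p f)
    (f : MvPolynomial (Fin k × Fin k) ℚ) (m : Fin k × Fin k →₀ ℕ) :
    coeff m (φ (Matrix.of fun i j => d (i, j)).det f) =
      ∑ σ : Equiv.Perm (Fin k), ((Equiv.Perm.sign σ : ℤ) : ℚ) *
        ((∏ i, ((m (i, σ i) : ℚ) + 1)) *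
          coeff (m + ∑ i, Finsupp.single (i, σ i) 1) f) := by
  rw [← Matrix.det_transpose, Matrix.det_apply, map_sum, LinearMap.sum_apply, coeff_sum]
  refine Finset.sum_congr rfl fun σ _ => ?_
  simp only [Matrix.transpose_apply, Matrix.of_apply]
  rw [← coeff_prod_pderiv_apply φ d hd σ Finset.univ]
  rcases Int.units_eq_one_or (Equiv.Perm.sign σ) with h | h <;> simp [h]

theorem detX_eq_sum_monomial :
    detX k = ∑ τ : Equiv.Perm (Fin k),
      monomial (∑ i, Finsupp.single (i, τ i) 1) ((Equiv.Perm.sign τ : ℤ) : ℚ) := by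
  rw [detX, ← Matrix.det_transpose, Matrix.det_apply']
  refine Finset.sum_congr rfl fun τ _ => ?_
  rw [monomial_sum_index, map_intCast]
  rfl

theorem coeff_detX_pow_succ (l : ℕ) (m : Fin k × Fin k →₀ ℕ) :
    coeff m (detX k ^ (l + 1)) = ∑ τ : Equiv.Perm (Fin k),
      if ∑ i, Finsupp.single (i, τ i) 1 ≤ m then
        coeff (m - ∑ i, Finsupp.single (i, τ i) 1) (detX k ^ l) *
          ((Equiv.Perm.sign τ : ℤ) : ℚ) else 0 := by
  rw [pow_succ]
  nth_rw 2 [detX_eq_sum_monomial]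
  rw [Finset.mul_sum, coeff_sum]
  exact Finset.sum_congr rfl fun τ _ => coeff_mul_monomial' _ _ _ _

theorem sum_single_perm_apply (σ : Equiv.Perm (Fin k)) (a b : Fin k) :
    (∑ i, Finsupp.single (i, σ i) 1 : Fin k × Fin k →₀ ℕ) (a, b) = if σ a = b then 1 else 0 := by
  rw [Finsupp.finsetSum_apply, Finset.sum_eq_single a]
  · simp [Finsupp.single_apply]
  · intro i _ hi
    simp [hi]
  · simp

theorem mulCoeffZ_add_sub (l : ℕ) (M : Matrix (Fin k) (Fin k) ℕ) (σ τ : Equiv.Perm (Fin k)) :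
    mulCoeffZ k l ((Matrix.of fun a b => (M a b : ℤ)) + permMatZ k σ - permMatZ k τ) =
      if ∑ i, Finsupp.single (i, τ i) 1 ≤
          (Finsupp.equivFunOnFinite.symm fun p : Fin k × Fin k => M p.1 p.2) +
            ∑ i, Finsupp.single (i, σ i) 1 then
        coeff ((Finsupp.equivFunOnFinite.symm fun p : Fin k × Fin k => M p.1 p.2) +
            ∑ i, Finsupp.single (i, σ i) 1 - ∑ i, Finsupp.single (i, τ i) 1) (detX k ^ l)
      else 0 := by
  classical
  rw [mulCoeffZ]
  refine if_congr ?_ ?_ rfl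
  · rw [Finsupp.le_def, Prod.forall]
    refine forall_congr' fun a => forall_congr' fun b => ?_
    rw [Finsupp.add_apply, sum_single_perm_apply, sum_single_perm_apply]
    simp only [permMatZ, Matrix.sub_apply, Matrix.add_apply, Matrix.of_apply,
      Finsupp.equivFunOnFinite_symm_apply_apply]
    split_ifs <;> omega
  · rw [mulCoeff]
    congr 1
    ext ⟨a, b⟩
    rw [Finsupp.tsub_apply, Finsupp.add_apply, sum_single_perm_apply, sum_single_perm_apply]
    simp only [permMatZ, Matrix.sub_apply, Matrix.add_apply, Matrix.of_apply,
      Finsupp.equivFunOnFinite_symm_apply_apply]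
    split_ifs <;> omega

end Cayley

/-- `Σ_{σ,τ ∈ S_k} (∏_a (m_{a,σ(a)}+1)) sgn(σ) sgn(τ) mul(M + R(σ) - R(τ))
    = ((k+l)!/l!) mul(M)` for `M ∈ 𝓜_{l,k}`, with the convention `mul(M') = 0` when `M'` has a
negative entry. -/
theorem sum_sign_sign_mulCoeff_add_sub_perm (k l : ℕ) (hk : 0 < k) (hl : 0 < l)
    (M : Matrix (Fin k) (Fin k) ℕ) (hM : IsMagic k l M) :
    (∑ σ : Equiv.Perm (Fin k), ∑ τ : Equiv.Perm (Fin k),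
      ((∏ a, (M a (σ a) + 1) : ℕ) : ℚ) * ((Equiv.Perm.sign σ : ℤ) : ℚ) *
        ((Equiv.Perm.sign τ : ℤ) : ℚ) *
        mulCoeffZ k l ((Matrix.of fun a b => (M a b : ℤ)) + permMatZ k σ - permMatZ k τ)) =
      (((k + l).factorial : ℚ) / (l.factorial : ℚ)) * mulCoeff k l M := by
  obtain ⟨A, _, φ, d, hd⟩ := exists_commRing_pderiv (Fin k × Fin k) ℚ
  have h := congrArg
    (coeff (Finsupp.equivFunOnFinite.symm fun p : Fin k × Fin k => M p.1 p.2))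
    (det_pderiv_apply_detX_pow φ d hk hd l)
  rw [coeff_det_pderiv_apply φ d hd, ← map_natCast (C : ℚ →+* _), coeff_C_mul] at h
  have hfac : ((l + 1).ascFactorial k : ℚ) = (k + l).factorial / l.factorial := by
    rw [eq_div_iff (by exact_mod_cast l.factorial_ne_zero), mul_comm, add_comm k l]
    exact_mod_cast Nat.factorial_mul_ascFactorial l k
  rw [← hfac, mulCoeff, ← h]
  refine Finset.sum_congr rfl fun σ _ => ?_
  rw [coeff_detX_pow_succ, Finset.mul_sum, Finset.mul_sum]
  refine Finset.sum_congr rfl fun τ _ => ?_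
  rw [mulCoeffZ_add_sub]
  push_cast
  simp only [Finsupp.equivFunOnFinite_symm_apply_apply]
  split_ifs <;> ring
end

section
/- Let k and l be positive integers. Then Σ_{M∈𝓜_{l+1,k}} (∏_{a,b=1}^{k} m_{a,b}!) · mul_{l+1}(M)² = ((l+k)!/l!) · Σ_{M∈𝓜_{l,k}} (∏_{a,b=1}^{k} m_{a,b}!) · mul_l(M)². -/
open scoped BigOperators

open MvPolynomial

namespace Matrix

variable {n R : Type*} [Fintype n] [DecidableEq n] [CommRing R]

/-- The exchange (Plücker) relation between two determinants. -/
theorem det_mul_det_eq_sum_updateCol (A B : Matrix n n R) (j : n) :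
    A.det * B.det =
      ∑ b, (A.updateCol j fun a => B a b).det * (B.updateCol b fun a => A a j).det := by
  have h : B.det • (fun a => A a j) = ∑ b, B.cramer (fun a => A a j) b • fun a => B a b := by
    rw [← mulVec_cramer]
    ext a
    simp [mulVec, dotProduct, mul_comm]
  have hcol := congrFun (congrArg A.cramer h) j
  rw [map_smul, map_sum] at hcol
  simp only [map_smul, Finset.sum_apply, Pi.smul_apply, cramer_apply, smul_eq_mul] at hcol
  have hA : (A.updateCol j fun a => A a j) = A := updateCol_eq_self A j
  rw [hA] at hcol
  rw [mul_comm, hcol]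
  exact Finset.sum_congr rfl fun b _ => mul_comm _ _

/-- A derivation that kills all columns of a matrix but one acts on the determinant
through that column. -/
theorem derivation_det_eq_det_updateCol {K : Type*} [CommRing K] [Algebra K R]
    (D : Derivation K R R) (A : Matrix n n R) (j : n) (h : ∀ a b, b ≠ j → D (A a b) = 0) :
    D A.det = (A.updateCol j fun a => D (A a j)).det := by
  have hprod (τ : Equiv.Perm n) (s : Finset n) (hs : j ∉ s) : D (∏ b ∈ s, A (τ b) b) = 0 := by
    induction s using Finset.induction_on with
    | empty => simp
    | insert b s hb ih =>
      rw [Finset.mem_insert, not_or] at hs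
      rw [Finset.prod_insert hb, Derivation.leibniz, ih hs.2, h _ _ (Ne.symm hs.1)]
      simp
  rw [det_apply', det_apply', map_sum]
  refine Finset.sum_congr rfl fun τ _ => ?_
  rw [← Finset.mul_prod_erase _ _ (Finset.mem_univ j),
    ← Finset.mul_prod_erase _ (fun b => A.updateCol j _ (τ b) b) (Finset.mem_univ j),
    Derivation.leibniz, Derivation.leibniz, hprod τ _ (Finset.notMem_erase _ _),
    Derivation.map_intCast, updateCol_self]
  have : ∏ b ∈ Finset.univ.erase j, A.updateCol j (fun a => D (A a j)) (τ b) b =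
      ∏ b ∈ Finset.univ.erase j, A (τ b) b :=
    Finset.prod_congr rfl fun b hb => updateCol_ne (Finset.ne_of_mem_erase hb)
  rw [this]
  simp only [smul_eq_mul]
  ring

end Matrix

/-- The Fischer inner product on polynomials, for which distinct monomials are orthogonal and
`x ^ d` has square norm `∏ i, (d i)!`. -/
noncomputable def fischer {ι : Type*} [Fintype ι] :
    MvPolynomial ι ℚ →ₗ[ℚ] MvPolynomial ι ℚ →ₗ[ℚ] ℚ :=
  (basisMonomials ι ℚ).constr ℚ fun d => (∏ i, ((d i).factorial : ℚ)) • lcoeff ℚ d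

section Fischer

variable {ι : Type*} [Fintype ι]

theorem fischer_monomial (d : ι →₀ ℕ) (c : ℚ) (g : MvPolynomial ι ℚ) :
    fischer (monomial d c) g = c * ((∏ i, ((d i).factorial : ℚ)) * coeff d g) := by
  have h : monomial d c = c • basisMonomials ι ℚ d := by
    simp [coe_basisMonomials, smul_monomial]
  rw [h, map_smul, fischer, Module.Basis.constr_basis]
  simp

theorem fischer_apply (f g : MvPolynomial ι ℚ) :
    fischer f g = ∑ d ∈ f.support, (∏ i, ((d i).factorial : ℚ)) * (coeff d f * coeff d g) := by
  conv_lhs => rw [f.as_sum]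
  rw [map_sum, LinearMap.sum_apply]
  refine Finset.sum_congr rfl fun d _ => ?_
  rw [fischer_monomial]
  ring

/-- Multiplication by a variable is adjoint to the corresponding partial derivative. -/
theorem fischer_mul_X (f g : MvPolynomial ι ℚ) (p : ι) :
    fischer (f * X p) g = fischer f (pderiv p g) := by
  classical
  induction f using MvPolynomial.induction_on' with
  | monomial d c =>
    rw [X, monomial_mul, mul_one, fischer_monomial, fischer_monomial, coeff_pderiv]
    have h : ∏ i, (((d + Finsupp.single p 1 : ι →₀ ℕ) i).factorial : ℚ) =
        (∏ i, ((d i).factorial : ℚ)) * (d p + 1) := by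
      rw [← Finset.mul_prod_erase _ _ (Finset.mem_univ p),
        ← Finset.mul_prod_erase _ (fun i => ((d i).factorial : ℚ)) (Finset.mem_univ p)]
      have : ∏ i ∈ Finset.univ.erase p, (((d + Finsupp.single p 1 : ι →₀ ℕ) i).factorial : ℚ) =
          ∏ i ∈ Finset.univ.erase p, ((d i).factorial : ℚ) :=
        Finset.prod_congr rfl fun i hi => by
          simp [Finsupp.single_eq_of_ne (Finset.ne_of_mem_erase hi)]
      rw [this]
      simp [Nat.factorial_succ]
      ring
    rw [h]
    ring
  | add f₁ f₂ h₁ h₂ => rw [add_mul, map_add, map_add, LinearMap.add_apply, h₁, h₂,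
      LinearMap.add_apply]

end Fischer

section Cayley

variable {k : ℕ}

/-- The generic matrix whose first `m` columns are replaced by the standard basis vectors
`e_{σ b}`. -/
noncomputable def mixedMatrix (m : ℕ) (σ : Equiv.Perm (Fin k)) :
    Matrix (Fin k) (Fin k) (MvPolynomial (Fin k × Fin k) ℚ) :=
  Matrix.of fun a b => if (b : ℕ) < m then (if σ b = a then 1 else 0) else X (a, b)

/-- The part of the monomial of `σ` in the determinant coming from the columns of index at
least `m`. -/
noncomputable def tailMonomial (m : ℕ) (σ : Equiv.Perm (Fin k)) :
    MvPolynomial (Fin k × Fin k) ℚ :=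
  ∏ b with m ≤ (b : Fin k).val, X (σ b, b)

/-- The generic determinant with column `j` replaced by the standard basis vector `e_i`. -/
noncomputable def detUpdate (i j : Fin k) : MvPolynomial (Fin k × Fin k) ℚ :=
  ((Matrix.of fun a b : Fin k => (X (a, b) : MvPolynomial (Fin k × Fin k) ℚ)).updateCol j
    (Pi.single i 1)).det

theorem pderiv_det_mixedMatrix {m : ℕ} (j : Fin k) (hj : m ≤ j) (σ : Equiv.Perm (Fin k))
    (i : Fin k) :
    pderiv (i, j) (mixedMatrix m σ).det =
      ((mixedMatrix m σ).updateCol j (Pi.single i 1)).det := by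
  rw [Matrix.derivation_det_eq_det_updateCol _ _ j]
  · congr 2
    ext1 a
    simp only [mixedMatrix, Matrix.of_apply, not_lt.mpr hj, if_false, pderiv_X]
    simp [Pi.single_apply, eq_comm]
  · intro a b hb
    simp only [mixedMatrix, Matrix.of_apply]
    split_ifs
    · exact Derivation.map_one_eq_zero _
    · exact map_zero _
    · exact pderiv_X_of_ne (by simp [hb])

theorem mixedMatrix_zero (σ : Equiv.Perm (Fin k)) :
    mixedMatrix 0 σ = Matrix.of fun a b => X (a, b) := by
  ext1 a b
  simp [mixedMatrix]

theorem det_mixedMatrix_zero (σ : Equiv.Perm (Fin k)) : (mixedMatrix 0 σ).det = detX k := by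
  rw [mixedMatrix_zero, detX]

theorem mixedMatrix_succ (j : Fin k) (σ : Equiv.Perm (Fin k)) :
    mixedMatrix (j + 1) σ = (mixedMatrix j σ).updateCol j (Pi.single (σ j) 1) := by
  ext1 a b
  rcases eq_or_ne b j with rfl | hb
  · simp [mixedMatrix, Pi.single_apply, eq_comm]
  · have : (b : ℕ) < j + 1 ↔ (b : ℕ) < j := by
      have := Fin.val_ne_of_ne hb
      omega
    simp only [mixedMatrix, Matrix.of_apply, Matrix.updateCol_ne hb, this]

theorem pderiv_detX_s7 (i j : Fin k) : pderiv (i, j) (detX k) = detUpdate i j := by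
  rw [← det_mixedMatrix_zero 1, pderiv_det_mixedMatrix j (Nat.zero_le _), mixedMatrix_zero,
    detUpdate]

theorem det_mixedMatrix_card (σ : Equiv.Perm (Fin k)) :
    (mixedMatrix k σ).det = ((Equiv.Perm.sign σ : ℤ) : MvPolynomial (Fin k × Fin k) ℚ) := by
  have h : mixedMatrix k σ = (1 : Matrix (Fin k) (Fin k) _).submatrix id σ := by
    ext1 a b
    simp [mixedMatrix, Matrix.one_apply, eq_comm]
  rw [h, Matrix.det_permute', Matrix.det_one, mul_one]

/-- Moving the original `j`-th column back into an earlier place `b` of the replaced columns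
amounts to precomposing `σ` with a transposition. -/
theorem det_mixedMatrix_succ_updateCol {b j : Fin k} (hbj : b ≤ j) (σ : Equiv.Perm (Fin k)) :
    ((mixedMatrix (j + 1) σ).updateCol b fun a => X (a, j)).det =
      ((Equiv.Perm.sign (Equiv.swap b j) : ℤ) : MvPolynomial (Fin k × Fin k) ℚ) *
        (mixedMatrix j (σ * Equiv.swap b j)).det := by
  rw [← Matrix.det_permute']
  congr 1
  ext1 a c
  rw [Matrix.submatrix_apply, id]
  rcases eq_or_ne c b with rfl | hcb
  · simp [mixedMatrix]
  rw [Matrix.updateCol_ne hcb]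
  rcases eq_or_ne c j with rfl | hcj
  · simp [mixedMatrix, lt_of_le_of_ne hbj hcb.symm]
  · have : (c : ℕ) < j + 1 ↔ (c : ℕ) < j := by
      have := Fin.val_ne_of_ne hcj
      omega
    simp only [mixedMatrix, Matrix.of_apply, Equiv.Perm.mul_apply,
      Equiv.swap_apply_of_ne_of_ne hcb hcj, this]

theorem detX_mul_det_mixedMatrix_succ (j : Fin k) (σ : Equiv.Perm (Fin k)) :
    detX k * (mixedMatrix (j + 1) σ).det =
      ∑ b ∈ Finset.Iic j,
        ((Equiv.Perm.sign (Equiv.swap b j) : ℤ) : MvPolynomial (Fin k × Fin k) ℚ) *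
          (detUpdate ((σ * Equiv.swap b j) j) j *
            (mixedMatrix j (σ * Equiv.swap b j)).det) := by
  rw [detX, Matrix.det_mul_det_eq_sum_updateCol _ _ j]
  symm
  refine Finset.sum_subset_zero_on_sdiff (Finset.subset_univ _) (fun b hb => ?_) fun b hb => ?_
  · have hjb : j < b := by simpa using hb
    have : (fun a => mixedMatrix (j + 1) σ a b) =
        fun a => (Matrix.of fun a b : Fin k =>
          (X (a, b) : MvPolynomial (Fin k × Fin k) ℚ)) a b := by
      ext1 a
      simp [mixedMatrix, hjb.not_ge]
    rw [this, Matrix.det_updateCol_eq_zero hjb.ne', zero_mul]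
  · have hbj : b ≤ j := Finset.mem_Iic.mp hb
    have hcol : (fun a => mixedMatrix (j + 1) σ a b) = Pi.single (σ b) 1 := by
      ext1 a
      simp [mixedMatrix, hbj, Pi.single_apply, eq_comm]
    rw [hcol]
    simp only [Matrix.of_apply]
    rw [det_mixedMatrix_succ_updateCol hbj, detUpdate, Equiv.Perm.mul_apply,
      Equiv.swap_apply_right]
    ring

theorem tailMonomial_eq_mul_X (j : Fin k) (σ : Equiv.Perm (Fin k)) :
    tailMonomial j σ = tailMonomial (j + 1) σ * X (σ j, j) := by
  have h : Finset.univ.filter (fun b : Fin k => (j : ℕ) ≤ b) =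
      insert j (Finset.univ.filter fun b : Fin k => (j : ℕ) + 1 ≤ b) := by
    ext b
    simp only [Finset.mem_filter, Finset.mem_insert, Finset.mem_univ, true_and, Fin.ext_iff]
    omega
  rw [tailMonomial, h, Finset.prod_insert (by simp), mul_comm, tailMonomial]

theorem tailMonomial_succ_mul_swap {b j : Fin k} (hbj : b ≤ j) (σ : Equiv.Perm (Fin k)) :
    tailMonomial (j + 1) (σ * Equiv.swap b j) = tailMonomial (j + 1) σ := by
  refine Finset.prod_congr rfl fun c hc => ?_
  have hjc : j < c := (Finset.mem_filter.mp hc).2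
  rw [Equiv.Perm.mul_apply, Equiv.swap_apply_of_ne_of_ne (hbj.trans_lt hjc).ne' hjc.ne']

/-- The sum interpolating between `k! * ⟨det ^ l, det ^ l⟩` and
`⟨det ^ (l + 1), det ^ (l + 1)⟩`. -/
noncomputable def mixedSum (k l m : ℕ) : ℚ :=
  ∑ σ : Equiv.Perm (Fin k), ((Equiv.Perm.sign σ : ℤ) : ℚ) *
    fischer (detX k ^ l * tailMonomial m σ) (detX k ^ l * (mixedMatrix m σ).det)

theorem mixedSum_zero (k l : ℕ) :
    mixedSum k l 0 = fischer (detX k ^ (l + 1)) (detX k ^ (l + 1)) := by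
  have h : detX k ^ (l + 1) = ∑ σ : Equiv.Perm (Fin k),
      ((Equiv.Perm.sign σ : ℤ) : ℚ) • (detX k ^ l * tailMonomial 0 σ) := by
    rw [pow_succ]
    conv_lhs => enter [2]; rw [detX, Matrix.det_apply']
    rw [Finset.mul_sum]
    refine Finset.sum_congr rfl fun σ _ => ?_
    simp only [tailMonomial, Nat.zero_le, Finset.filter_true, Matrix.of_apply, smul_eq_C_mul,
      map_intCast]
    ring
  conv_rhs => enter [1]; rw [h]
  rw [map_sum, LinearMap.sum_apply, mixedSum]
  refine Finset.sum_congr rfl fun σ _ => ?_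
  rw [det_mixedMatrix_zero, map_smul, LinearMap.smul_apply, smul_eq_mul, pow_succ]

theorem mixedSum_card (k l : ℕ) :
    mixedSum k l k = k.factorial * fischer (detX k ^ l) (detX k ^ l) := by
  have h (σ : Equiv.Perm (Fin k)) : ((Equiv.Perm.sign σ : ℤ) : ℚ) *
      fischer (detX k ^ l * tailMonomial k σ) (detX k ^ l * (mixedMatrix k σ).det) =
        fischer (detX k ^ l) (detX k ^ l) := by
    have htail : tailMonomial k σ = 1 :=
      Finset.prod_eq_one fun b hb => absurd (Finset.mem_filter.mp hb).2 (not_le.mpr b.isLt)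
    have hdet : detX k ^ l * (mixedMatrix k σ).det =
        ((Equiv.Perm.sign σ : ℤ) : ℚ) • detX k ^ l := by
      rw [det_mixedMatrix_card, smul_eq_C_mul, map_intCast, mul_comm]
    rw [htail, hdet, mul_one, map_smul, smul_eq_mul, ← mul_assoc]
    rcases Int.units_eq_one_or (Equiv.Perm.sign σ) with hs | hs <;> simp [hs]
  simp [mixedSum, h, Fintype.card_perm]

theorem pderiv_detX_pow_mul (l : ℕ) (j : Fin k) (σ : Equiv.Perm (Fin k)) :
    pderiv (σ j, j) (detX k ^ (l + 1) * (mixedMatrix j σ).det) =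
      ((l + 1 : ℕ) : ℚ) • (detX k ^ l * (detUpdate (σ j) j * (mixedMatrix j σ).det)) +
        detX k ^ (l + 1) * (mixedMatrix (j + 1) σ).det := by
  rw [pderiv_mul, pderiv_pow, pderiv_detX_s7, pderiv_det_mixedMatrix j le_rfl, ← mixedMatrix_succ,
    smul_eq_C_mul, map_natCast, Nat.add_sub_cancel]
  ring

theorem sum_fischer_detUpdate (l : ℕ) (j : Fin k) :
    (j + 1 : ℚ) * ∑ σ : Equiv.Perm (Fin k), ((Equiv.Perm.sign σ : ℤ) : ℚ) *
      fischer (detX k ^ (l + 1) * tailMonomial (j + 1) σ)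
        (detX k ^ l * (detUpdate (σ j) j * (mixedMatrix j σ).det)) =
      mixedSum k (l + 1) (j + 1) := by
  set F : Equiv.Perm (Fin k) → ℚ := fun σ => ((Equiv.Perm.sign σ : ℤ) : ℚ) *
      fischer (detX k ^ (l + 1) * tailMonomial (j + 1) σ)
        (detX k ^ l * (detUpdate (σ j) j * (mixedMatrix j σ).det)) with hF
  have h (σ : Equiv.Perm (Fin k)) : ((Equiv.Perm.sign σ : ℤ) : ℚ) *
      fischer (detX k ^ (l + 1) * tailMonomial (j + 1) σ)
        (detX k ^ (l + 1) * (mixedMatrix (j + 1) σ).det) =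
      ∑ b ∈ Finset.Iic j, F (σ * Equiv.swap b j) := by
    have hsum : detX k ^ (l + 1) * (mixedMatrix (j + 1) σ).det =
        ∑ b ∈ Finset.Iic j, ((Equiv.Perm.sign (Equiv.swap b j) : ℤ) : ℚ) •
          (detX k ^ l * (detUpdate ((σ * Equiv.swap b j) j) j *
            (mixedMatrix j (σ * Equiv.swap b j)).det)) := by
      rw [pow_succ, mul_assoc, detX_mul_det_mixedMatrix_succ, Finset.mul_sum]
      refine Finset.sum_congr rfl fun b _ => ?_
      rw [smul_eq_C_mul, map_intCast]
      ring
    rw [hsum, map_sum, Finset.mul_sum]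
    refine Finset.sum_congr rfl fun b hb => ?_
    rw [hF]
    simp only
    rw [tailMonomial_succ_mul_swap (Finset.mem_Iic.mp hb), map_smul, smul_eq_mul,
      Equiv.Perm.sign_mul]
    push_cast
    ring
  rw [mixedSum, Finset.sum_congr rfl fun σ _ => h σ, Finset.sum_comm]
  have hshift (b : Fin k) : ∑ σ, F (σ * Equiv.swap b j) = ∑ σ, F σ :=
    Equiv.sum_comp (Equiv.mulRight (Equiv.swap b j)) F
  simp [hshift]

theorem mixedSum_step (l : ℕ) (j : Fin k) :
    (j + 1 : ℚ) * mixedSum k (l + 1) j = (l + 1 + j + 1) * mixedSum k (l + 1) (j + 1) := by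
  have h : mixedSum k (l + 1) j = (l + 1 : ℚ) * (∑ σ : Equiv.Perm (Fin k),
      ((Equiv.Perm.sign σ : ℤ) : ℚ) *
        fischer (detX k ^ (l + 1) * tailMonomial (j + 1) σ)
          (detX k ^ l * (detUpdate (σ j) j * (mixedMatrix j σ).det))) +
      mixedSum k (l + 1) (j + 1) := by
    rw [mixedSum, mixedSum, Finset.mul_sum, ← Finset.sum_add_distrib]
    refine Finset.sum_congr rfl fun σ _ => ?_
    rw [tailMonomial_eq_mul_X, ← mul_assoc, fischer_mul_X, pderiv_detX_pow_mul, map_add,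
      map_smul, smul_eq_mul]
    push_cast
    ring
  rw [h, mul_add, mul_left_comm, sum_fischer_detUpdate]
  ring

theorem factorial_mul_mixedSum_zero (l m : ℕ) (hm : m ≤ k) :
    (m.factorial : ℚ) * (l + 1).factorial * mixedSum k (l + 1) 0 =
      (l + 1 + m).factorial * mixedSum k (l + 1) m := by
  induction m with
  | zero => simp
  | succ m ih =>
    have hstep := mixedSum_step l (⟨m, hm⟩ : Fin k)
    simp only at hstep
    rw [← add_assoc, Nat.factorial_succ, Nat.factorial_succ (l + 1 + m)]
    push_cast at hstep ⊢
    linear_combination (m + 1 : ℚ) * ih (Nat.le_of_succ_le hm) +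
      ((l + 1 + m).factorial : ℚ) * hstep

/-- The norm form of Cayley's identity `det(∂) det ^ (l + 1) = (l + 1) ⋯ (l + k) det ^ l`. -/
theorem fischer_detX_pow_succ (k l : ℕ) (hl : 0 < l) :
    fischer (detX k ^ (l + 1)) (detX k ^ (l + 1)) =
      (((l + k).factorial : ℚ) / (l.factorial : ℚ)) * fischer (detX k ^ l) (detX k ^ l) := by
  obtain ⟨l, rfl⟩ := Nat.exists_eq_add_one_of_ne_zero hl.ne'
  have h := factorial_mul_mixedSum_zero l k le_rfl
  rw [mixedSum_zero, mixedSum_card] at h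
  have hk : (k.factorial : ℚ) ≠ 0 := by exact_mod_cast k.factorial_ne_zero
  have hl' : ((l + 1).factorial : ℚ) ≠ 0 := by exact_mod_cast (l + 1).factorial_ne_zero
  rw [div_mul_eq_mul_div, eq_div_iff hl']
  refine mul_left_cancel₀ hk ?_
  linear_combination h

end Cayley

section Magic

theorem isWeightedHomogeneous_detX_row (k : ℕ) (r : Fin k) :
    IsWeightedHomogeneous (fun p : Fin k × Fin k => if p.1 = r then 1 else 0) (detX k) 1 := by
  rw [detX, Matrix.det_apply']
  refine IsWeightedHomogeneous.sum _ _ _ fun σ _ => ?_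
  have h := IsWeightedHomogeneous.prod (R := ℚ) Finset.univ
    (fun b => (X (σ b, b) : MvPolynomial (Fin k × Fin k) ℚ)) _
    fun b _ => isWeightedHomogeneous_X ℚ (fun p : Fin k × Fin k => if p.1 = r then 1 else 0)
      (σ b, b)
  have hsum : ∑ b, (if σ b = r then 1 else 0) = 1 := by
    rw [Equiv.sum_comp σ fun c => if c = r then 1 else 0]
    simp
  rw [hsum] at h
  simpa using h.C_mul ((Equiv.Perm.sign σ : ℤ) : ℚ)

theorem isWeightedHomogeneous_detX_col (k : ℕ) (c : Fin k) :
    IsWeightedHomogeneous (fun p : Fin k × Fin k => if p.2 = c then 1 else 0) (detX k) 1 := by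
  rw [detX, Matrix.det_apply']
  refine IsWeightedHomogeneous.sum _ _ _ fun σ _ => ?_
  have h := IsWeightedHomogeneous.prod (R := ℚ) Finset.univ
    (fun b => (X (σ b, b) : MvPolynomial (Fin k × Fin k) ℚ)) _
    fun b _ => isWeightedHomogeneous_X ℚ (fun p : Fin k × Fin k => if p.2 = c then 1 else 0)
      (σ b, b)
  have hsum : ∑ b, (if b = c then 1 else 0) = 1 := by simp
  rw [hsum] at h
  simpa using h.C_mul ((Equiv.Perm.sign σ : ℤ) : ℚ)

theorem isMagic_of_mulCoeff_ne_zero {k l : ℕ} {M : Matrix (Fin k) (Fin k) ℕ}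
    (h : mulCoeff k l M ≠ 0) : IsMagic k l M := by
  refine ⟨fun r => ?_, fun c => ?_⟩
  · have hdeg := (isWeightedHomogeneous_detX_row k r).pow l h
    simpa [Finsupp.weight_apply, Finsupp.sum_fintype, Fintype.sum_prod_type,
      Finset.sum_ite_irrel] using hdeg
  · have hdeg := (isWeightedHomogeneous_detX_col k c).pow l h
    simpa [Finsupp.weight_apply, Finsupp.sum_fintype, Fintype.sum_prod_type] using hdeg

/-- Exponent vectors of monomials in the matrix entries, as matrices. -/
noncomputable def exponentEquiv (k : ℕ) :
    (Fin k × Fin k →₀ ℕ) ≃ Matrix (Fin k) (Fin k) ℕ :=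
  Finsupp.equivFunOnFinite.trans (Equiv.curry (Fin k) (Fin k) ℕ)

theorem mulCoeff_exponentEquiv (k l : ℕ) (d : Fin k × Fin k →₀ ℕ) :
    mulCoeff k l (exponentEquiv k d) = coeff d (detX k ^ l) := by
  rw [mulCoeff]
  congr 1
  ext p
  rfl

theorem finsum_isMagic_eq_fischer (k l : ℕ) :
    (∑ᶠ (M : Matrix (Fin k) (Fin k) ℕ) (_ : IsMagic k l M),
      (∏ a, ∏ b, ((M a b).factorial : ℚ)) * (mulCoeff k l M) ^ 2) =
      fischer (detX k ^ l) (detX k ^ l) := by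
  have h (M : Matrix (Fin k) (Fin k) ℕ) :
      (∑ᶠ _ : IsMagic k l M, (∏ a, ∏ b, ((M a b).factorial : ℚ)) * (mulCoeff k l M) ^ 2) =
        (∏ a, ∏ b, ((M a b).factorial : ℚ)) * (mulCoeff k l M) ^ 2 := by
    classical
    rw [finsum_eq_if]
    split_ifs with hM
    · rfl
    · have : mulCoeff k l M = 0 := by
        by_contra hne
        exact hM (isMagic_of_mulCoeff_ne_zero hne)
      simp [this]
  rw [finsum_congr h, ← finsum_comp_equiv (exponentEquiv k), fischer_apply]
  rw [finsum_eq_sum_of_support_subset (s := (detX k ^ l).support)]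
  · refine Finset.sum_congr rfl fun d _ => ?_
    rw [mulCoeff_exponentEquiv, Fintype.prod_prod_type, pow_two]
    rfl
  · intro d hd
    rw [Finset.mem_coe, mem_support_iff]
    intro h0
    exact hd (by simp [mulCoeff_exponentEquiv, h0])

end Magic

/-- `C(l+1,k) = ((l+k)!/l!) · C(l,k)` where
`C(l,k) = Σ_{M ∈ 𝓜_{l,k}} (∏_{a,b} m_{a,b}!) · mul_l(M)²`. -/
theorem magic_sum_succ_eq_ratio_mul_magic_sum (k l : ℕ) (hk : 0 < k) (hl : 0 < l) :
    (∑ᶠ (M : Matrix (Fin k) (Fin k) ℕ) (_ : IsMagic k (l + 1) M),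
      (∏ a, ∏ b, ((M a b).factorial : ℚ)) * (mulCoeff k (l + 1) M) ^ 2) =
      (((l + k).factorial : ℚ) / (l.factorial : ℚ)) *
        ∑ᶠ (M : Matrix (Fin k) (Fin k) ℕ) (_ : IsMagic k l M),
          (∏ a, ∏ b, ((M a b).factorial : ℚ)) * (mulCoeff k l M) ^ 2 := by
  rw [finsum_isMagic_eq_fischer, finsum_isMagic_eq_fischer, fischer_detX_pow_succ k l hl]
end

section
/- Let k and l be positive integers. In the exterior algebra Λ, det(Ω)^l = C(l,k) · ∏_{s=1}^{l} ∏_{i=1}^{k} (ψ^i_s ∧ ψ̄^i_s), where the scalar C(l,k) equals (∏_{j=0}^{k+l-1} j!) / ((∏_{j=0}^{k-1} j!) · (∏_{j=0}^{l-1} j!)) and the order of the (even, hence commuting) factors ψ^i_s ∧ ψ̄^i_s is immaterial. -/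
open scoped BigOperators

theorem Polynomial.isAddTorsionFree {R : Type*} [Semiring R] [IsAddTorsionFree R] :
    IsAddTorsionFree (Polynomial R) where
  nsmul_right_injective n hn p q h := by
    ext j
    exact nsmul_right_injective hn (by simpa using congrArg (fun p => p.coeff j) h)

theorem sum_pow_eq_factorial_mul_sum_prod {ι R : Type*} [CommSemiring R]
    (a : ι → R) (ha : ∀ i, a i * a i = 0) (s : Finset ι) (n : ℕ) :
    (∑ i ∈ s, a i) ^ n = n.factorial * ∑ t ∈ s.powersetCard n, ∏ i ∈ t, a i := by
  classical
  induction s using Finset.induction_on generalizing n with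
  | empty =>
    cases n with
    | zero => simp
    | succ n => simp [Finset.powersetCard_eq_empty.2 (show (∅ : Finset ι).card < n + 1 by simp)]
  | insert b s hb ih =>
    have key : ∀ n : ℕ, (a b + ∑ i ∈ s, a i) ^ (n + 1) =
        (∑ i ∈ s, a i) ^ (n + 1) + (n + 1 : ℕ) * (a b * (∑ i ∈ s, a i) ^ n) := by
      intro n
      induction n with
      | zero => simp [add_comm]
      | succ n ihn =>
        rw [pow_succ, ihn]
        push_cast
        have := ha b
        calc _ = (∑ i ∈ s, a i) ^ (n + 1 + 1)
              + (n + 1 + 1 : R) * (a b * (∑ i ∈ s, a i) ^ (n + 1))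
              + (n + 1 : R) * (∑ i ∈ s, a i) ^ n * (a b * a b) := by ring
          _ = _ := by rw [this]; ring
    rw [Finset.sum_insert hb]
    cases n with
    | zero => simp
    | succ n =>
      rw [key, ih, ih, Finset.powersetCard_succ_insert hb, Finset.sum_union, Finset.sum_image]
      · have : ∀ t ∈ s.powersetCard n, ∏ i ∈ insert b t, a i = a b * ∏ i ∈ t, a i := by
          intro t ht
          exact Finset.prod_insert fun h => hb ((Finset.mem_powersetCard.1 ht).1 h)
        rw [Finset.sum_congr rfl this, ← Finset.mul_sum, Nat.factorial_succ]
        push_cast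
        ring
      · intro t ht u hu h
        have ht' : b ∉ t := fun h => hb ((Finset.mem_powersetCard.1 ht).1 h)
        have hu' : b ∉ u := fun h => hb ((Finset.mem_powersetCard.1 hu).1 h)
        rw [← Finset.erase_insert ht', h, Finset.erase_insert hu']
      · rw [Finset.disjoint_left]
        intro t ht h
        obtain ⟨u, -, rfl⟩ := Finset.mem_image.1 h
        exact hb ((Finset.mem_powersetCard.1 ht).1 (Finset.mem_insert_self b u))

theorem sum_pow_eq_zero_of_card_lt {ι R : Type*} [CommSemiring R]
    (a : ι → R) (ha : ∀ i, a i * a i = 0) (s : Finset ι) {n : ℕ} (hn : s.card < n) :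
    (∑ i ∈ s, a i) ^ n = 0 := by
  rw [sum_pow_eq_factorial_mul_sum_prod a ha, Finset.powersetCard_eq_empty.2 hn]
  simp

namespace Polynomial

variable {R : Type*} [CommRing R]

theorem coeff_mul_mem_pow {I : Ideal R} {f g : R[X]} {a b : ℕ}
    (hf : ∀ j, f.coeff j ∈ I ^ (a - j)) (hg : ∀ j, g.coeff j ∈ I ^ (b - j)) (j : ℕ) :
    (f * g).coeff j ∈ I ^ (a + b - j) := by
  rw [coeff_mul]
  refine Ideal.sum_mem _ fun p hp => ?_
  have hp := Finset.HasAntidiagonal.mem_antidiagonal.1 hp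
  refine Ideal.pow_le_pow_right (show a + b - j ≤ (a - p.1) + (b - p.2) by lia) ?_
  rw [pow_add]
  exact Ideal.mul_mem_mul (hf _) (hg _)

theorem coeff_pow_mem_pow {I : Ideal R} {f : R[X]} {a : ℕ}
    (hf : ∀ j, f.coeff j ∈ I ^ (a - j)) (d j : ℕ) :
    (f ^ d).coeff j ∈ I ^ (d * a - j) := by
  induction d generalizing j with
  | zero => simp
  | succ d ih =>
    rw [pow_succ, Nat.succ_mul]
    exact coeff_mul_mem_pow ih hf j

theorem coeff_prod_mem_pow {ι : Type*} {I : Ideal R} (s : Finset ι)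
    (f : ι → R[X]) (hf : ∀ i ∈ s, ∀ j, (f i).coeff j ∈ I ^ (1 - j)) (j : ℕ) :
    (∏ i ∈ s, f i).coeff j ∈ I ^ (s.card - j) := by
  classical
  induction s using Finset.induction_on generalizing j with
  | empty => simp
  | insert b s hb ih =>
    rw [Finset.prod_insert hb, Finset.card_insert_of_notMem hb, add_comm]
    exact coeff_mul_mem_pow (hf b (by simp)) (ih fun i hi => hf i (by simp [hi])) j

end Polynomial

namespace Matrix

variable {n R : Type*} [CommRing R] [Fintype n] [DecidableEq n]

open Polynomial in
theorem coeff_det_add_X_smul_mem_pow {I : Ideal R} {A : Matrix n n R}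
    (hA : ∀ i j, A i j ∈ I) (N : Matrix n n R) (j : ℕ) :
    (det (A.map C + (X : R[X]) • N.map C)).coeff j ∈ I ^ (Fintype.card n - j) := by
  rw [det_apply, finsetSum_coeff]
  refine Ideal.sum_mem _ fun σ _ => ?_
  rw [Units.smul_def, coeff_smul]
  refine zsmul_mem (coeff_prod_mem_pow _ _ (fun i _ j => ?_) j) _
  rcases j with _ | j
  · simpa using hA _ _
  · simp

open Polynomial in
theorem det_add_X_smul_mem_reesAlgebra {J : Ideal R} {N : Matrix n n R}
    (hN : ∀ i j, N i j ∈ J) (A : Matrix n n R) :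
    det (A.map C + (X : R[X]) • N.map C) ∈ reesAlgebra J := by
  rw [det_apply]
  refine sum_mem fun σ _ => ?_
  rw [Units.smul_def]
  refine zsmul_mem (prod_mem fun i _ => add_mem ?_ ?_) _
  · exact (reesAlgebra J).algebraMap_mem (A _ _)
  · intro j
    rcases j with _ | _ | j <;> simp [coeff_monomial, hN]

end Matrix

/-- All `2 × 2` permanents of the matrix vanish, as they do for `ψ i * χ j` with `ψ`, `χ`
families of pairwise anticommuting elements. -/
def Matrix.IsOddRankOne {m n R : Type*} [CommRing R] (N : Matrix m n R) : Prop :=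
  ∀ i j p q, N i j * N p q + N i q * N p j = 0

namespace Matrix.IsOddRankOne

variable {l m n R S : Type*} [CommRing R] [CommRing S]

theorem submatrix {N : Matrix m n R} (hN : N.IsOddRankOne) {m' n' : Type*}
    (f : m' → m) (g : n' → n) : (N.submatrix f g).IsOddRankOne :=
  fun _ _ _ _ => hN _ _ _ _

theorem map {N : Matrix m n R} (hN : N.IsOddRankOne) (f : R →+* S) :
    (N.map f).IsOddRankOne := fun i j p q => by
  simpa using congrArg f (hN i j p q)

theorem mul_left {N : Matrix m n R} (hN : N.IsOddRankOne) [Fintype m] (A : Matrix l m R) :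
    (A * N).IsOddRankOne := fun i j p q => by
  simp only [mul_apply, Finset.sum_mul_sum, ← Finset.sum_add_distrib]
  refine Finset.sum_eq_zero fun a _ => Finset.sum_eq_zero fun b _ => ?_
  linear_combination A i a * A p b * hN a j b q

theorem mul_same_row [IsAddTorsionFree R] {N : Matrix m n R} (hN : N.IsOddRankOne) (i : m)
    (j q : n) : N i j * N i q = 0 := by
  have := hN i j i q
  rw [mul_comm (N i q), ← two_nsmul] at this
  exact (nsmul_eq_zero_iff_right two_ne_zero).1 this

variable [Fintype n] [DecidableEq n]

theorem prod_perm {N : Matrix n n R} (hN : N.IsOddRankOne) (σ : Equiv.Perm n) :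
    ∏ i, N (σ i) i = (Equiv.Perm.sign σ : ℤ) * ∏ i, N i i := by
  induction σ using Equiv.Perm.swap_induction_on' with
  | one => simp
  | mul_swap f x y hxy ih =>
    have split : ∀ g : n → R, ∏ i, g i = g x * g y * ∏ i ∈ (Finset.univ.erase x).erase y, g i := by
      intro g
      rw [mul_assoc, Finset.mul_prod_erase _ _ (by simp [hxy.symm]),
        Finset.mul_prod_erase _ _ (Finset.mem_univ x)]
    have h : ∏ i, N ((f * Equiv.swap x y) i) i = -∏ i, N (f i) i := by
      rw [split, split]
      have : ∏ i ∈ (Finset.univ.erase x).erase y, N ((f * Equiv.swap x y) i) i =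
          ∏ i ∈ (Finset.univ.erase x).erase y, N (f i) i := by
        refine Finset.prod_congr rfl fun i hi => ?_
        simp only [Finset.mem_erase, Finset.mem_univ, and_true] at hi
        rw [Equiv.Perm.mul_apply, Equiv.swap_apply_of_ne_of_ne hi.2 hi.1]
      rw [this]
      simp only [Equiv.Perm.mul_apply, Equiv.swap_apply_left, Equiv.swap_apply_right]
      linear_combination (∏ i ∈ (Finset.univ.erase x).erase y, N (f i) i) * hN (f y) x (f x) y
    rw [h, ih, Equiv.Perm.sign_mul, Equiv.Perm.sign_swap hxy]
    simp

theorem det_eq {N : Matrix n n R} (hN : N.IsOddRankOne) :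
    N.det = (Fintype.card n).factorial * ∏ i, N i i := by
  rw [det_apply']
  simp_rw [hN.prod_perm, ← mul_assoc, ← Int.cast_mul, ← Units.val_mul, Int.units_mul_self]
  simp [Fintype.card_perm]

open Polynomial in
theorem coeff_det_one_add_X_smul [IsAddTorsionFree R] {N : Matrix n n R} (hN : N.IsOddRankOne)
    (j : ℕ) : (det (1 + (X : R[X]) • N.map C)).coeff j = N.trace ^ j := by
  rw [coeff_det_one_add_X_smul_eq_sum_minors, trace,
    sum_pow_eq_factorial_mul_sum_prod N.diag (fun i => hN.mul_same_row i i i), Finset.mul_sum]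
  refine Finset.sum_congr rfl fun s hs => ?_
  rw [(hN.submatrix _ _).det_eq, Fintype.card_coe, (Finset.mem_powersetCard.1 hs).2]
  congr 1
  exact Finset.prod_coe_sort s fun i => N i i

open Polynomial in
theorem coeff_det_one_add_X_smul_pow [IsAddTorsionFree R] {N : Matrix n n R}
    (hN : N.IsOddRankOne) (d j : ℕ) :
    (det (1 + (X : R[X]) • N.map C) ^ (d + 1)).coeff j = (d + j).choose d * N.trace ^ j := by
  have h : ((det (1 + (X : R[X]) • N.map C) : R[X]) : PowerSeries R) =
      PowerSeries.rescale N.trace (PowerSeries.mk 1) := by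
    ext i
    simp [hN.coeff_det_one_add_X_smul, PowerSeries.coeff_rescale]
  rw [← Polynomial.coeff_coe, Polynomial.coe_pow, h, ← map_pow,
    PowerSeries.mk_one_pow_eq_mk_choose_add, PowerSeries.coeff_rescale, PowerSeries.coeff_mk,
    mul_comm]

omit [DecidableEq n] in
theorem trace_pow_card [IsAddTorsionFree R] {N : Matrix n n R} (hN : N.IsOddRankOne) :
    N.trace ^ Fintype.card n = (Fintype.card n).factorial * ∏ i, N i i := by
  rw [trace, sum_pow_eq_factorial_mul_sum_prod N.diag (fun i => hN.mul_same_row i i i),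
    ← Finset.card_univ, Finset.powersetCard_self]
  simp

open Polynomial in
/-- The fermionic Cayley identity for a matrix whose determinant is not a zero divisor. -/
theorem coeff_det_add_X_smul_pow_of_isRegular [IsAddTorsionFree R] {N : Matrix n n R}
    (hN : N.IsOddRankOne) (A : Matrix n n R) (hA : IsLeftRegular A.det) (d : ℕ) :
    (det (A.map C + (X : R[X]) • N.map C) ^ (d + 1)).coeff (Fintype.card n) =
      ((Fintype.card n).factorial * (d + Fintype.card n).choose d : ℕ) *
        (A.det ^ d * ∏ i, N i i) := by
  have hN' : (A.adjugate * N).IsOddRankOne := hN.mul_left _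
  have hcomp : (det (A.map C + (X : R[X]) • N.map C)).comp (C A.det * X) =
      C A.det * det (1 + (X : R[X]) • (A.adjugate * N).map C) := by
    have hdet : C A.det = det (A.map (C : R → R[X])) := RingHom.map_det C A
    rw [← coe_compRingHom_apply, RingHom.map_det, hdet, ← det_mul, mul_add, mul_one, Matrix.mul_smul,
      ← Matrix.map_mul, ← Matrix.mul_assoc, mul_adjugate, ← hdet]
    congr 1
    ext1 i j
    simp only [RingHom.mapMatrix_apply, map_apply, add_apply, smul_apply, smul_eq_mul, smul_mul,
      one_mul, coe_compRingHom_apply, add_comp, mul_comp, C_comp, X_comp, C_mul]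
    ring
  have hcoeff := congrArg (fun p => (p ^ (d + 1)).coeff (Fintype.card n)) hcomp
  simp only [← pow_comp, comp_C_mul_X_coeff] at hcoeff
  rw [mul_pow, ← C_pow, coeff_C_mul, hN'.coeff_det_one_add_X_smul_pow, hN'.trace_pow_card,
    ← hN'.det_eq, det_mul, hN.det_eq, det_adjugate] at hcoeff
  refine hA.pow (Fintype.card n) ?_
  have hpow : A.det ^ (d + 1) * A.det ^ (Fintype.card n - 1) =
      A.det ^ Fintype.card n * A.det ^ d := by
    rcases Nat.eq_zero_or_pos (Fintype.card n) with h | h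
    · simp [det_eq_one_of_card_eq_zero h]
    · rw [← pow_add, ← pow_add]
      congr 1
      lia
  push_cast
  linear_combination hcoeff + ((d + Fintype.card n).choose d * (Fintype.card n).factorial *
    ∏ i, N i i : R) * hpow

open Polynomial in
/-- The fermionic Cayley identity: the top coefficient of a power of the determinant in an
odd rank one perturbation is proportional to the previous power of the determinant. -/
theorem coeff_det_add_X_smul_pow [IsAddTorsionFree R] {N : Matrix n n R}
    (hN : N.IsOddRankOne) (A : Matrix n n R) (d : ℕ) :
    (det (A.map C + (X : R[X]) • N.map C) ^ (d + 1)).coeff (Fintype.card n) =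
      ((Fintype.card n).factorial * (d + Fintype.card n).choose d : ℕ) *
        (A.det ^ d * ∏ i, N i i) := by
  have := Polynomial.isAddTorsionFree (R := R)
  have hreg : IsLeftRegular (charmatrix (-A)).det :=
    ((charpoly_monic (-A)).isRegular).left
  have h := congrArg (evalRingHom (0 : R))
    ((hN.map (C : R →+* R[X])).coeff_det_add_X_smul_pow_of_isRegular (charmatrix (-A)) hreg d)
  have hA : (evalRingHom (0 : R)).mapMatrix (charmatrix (-A)) = A := by
    ext i j
    by_cases hij : i = j <;> simp [hij]
  rw [← Polynomial.coeff_map, Polynomial.map_pow, ← coe_mapRingHom, RingHom.map_det,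
    map_mul, map_mul, map_natCast, map_pow, RingHom.map_det, hA, map_prod] at h
  convert h using 5
  · ext1 i j
    have := congrFun (congrFun hA i) j
    simp_all
  · simp


omit [DecidableEq n] in
theorem exists_ideal_pow_eq_zero [IsAddTorsionFree R] {ι : Type*} [Fintype ι]
    {x : ι → Matrix n n R} (hx : ∀ s, (x s).IsOddRankOne) :
    ∃ I : Ideal R, (∀ s i j, x s i j ∈ I) ∧
      ∀ a, Fintype.card ι * Fintype.card n < a → I ^ a = 0 := by
  refine ⟨∑ p : ι × n, Ideal.span (Set.range (x p.1 p.2)), fun s i j => ?_, fun a ha => ?_⟩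
  · rw [Ideal.sum_eq_sup]
    exact Finset.le_sup (f := fun p : ι × n => Ideal.span (Set.range (x p.1 p.2)))
      (Finset.mem_univ (s, i)) (Ideal.subset_span ⟨j, rfl⟩)
  · refine sum_pow_eq_zero_of_card_lt _ (fun p => ?_) _ (by simpa using ha)
    rw [Ideal.span_mul_span', Ideal.zero_eq_bot, Ideal.span_eq_bot]
    rintro _ ⟨_, ⟨j, rfl⟩, _, ⟨q, rfl⟩, rfl⟩
    exact (hx p.1).mul_same_row p.2 j q

open Polynomial in
theorem det_sum_pow [IsAddTorsionFree R] {d : ℕ} {x : Fin d → Matrix n n R}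
    (hx : ∀ s, (x s).IsOddRankOne) :
    det (∑ s, x s) ^ d =
      (∏ s ∈ Finset.range d, (Fintype.card n).factorial * (s + Fintype.card n).choose s : ℕ) *
        ∏ s, ∏ i, x s i i := by
  induction d with
  | zero => simp
  | succ d ih =>
    obtain ⟨I, hxI, hI⟩ := exists_ideal_pow_eq_zero fun s : Fin d => hx s.castSucc
    obtain ⟨J, hxJ, hJ⟩ := exists_ideal_pow_eq_zero fun _ : Unit => hx (Fin.last d)
    set A := ∑ s : Fin d, x s.castSucc with hA
    set N := x (Fin.last d) with hN
    set f := det (A.map C + (X : R[X]) • N.map C) ^ (d + 1) with hf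
    have hAI : ∀ i j, A i j ∈ I := fun i j => by
      rw [hA, sum_apply]
      exact Ideal.sum_mem _ fun s _ => hxI s i j
    have hcoeff : ∀ j, j ≠ Fintype.card n → f.coeff j = 0 := by
      intro j hj
      rcases hj.lt_or_gt with hj | hj
      · have := coeff_pow_mem_pow (coeff_det_add_X_smul_mem_pow hAI N) (d + 1) j
        rwa [hI _ (by rw [Fintype.card_fin, Nat.succ_mul]; lia)] at this
      · have := pow_mem (det_add_X_smul_mem_reesAlgebra (hxJ ()) A) (d + 1) j
        rwa [hJ j (by simpa using hj)] at this
    have heval : f.eval 1 = f.coeff (Fintype.card n) := by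
      rw [eval_eq_sum, Polynomial.sum_def]
      simp only [one_pow, mul_one]
      by_cases h : Fintype.card n ∈ f.support
      · exact Finset.sum_eq_single_of_mem _ h fun j _ hj => hcoeff j hj
      · rw [notMem_support_iff.1 h]
        exact Finset.sum_eq_zero fun j hj => hcoeff j fun e => h (e ▸ hj)
    have hdet : det (A + N) ^ (d + 1) = f.eval 1 := by
      rw [hf, eval_pow, ← coe_evalRingHom, RingHom.map_det]
      congr 2
      ext i j
      simp
    rw [Fin.sum_univ_castSucc, hdet, heval, (hx (Fin.last d)).coeff_det_add_X_smul_pow A d,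
      ih fun s => hx s.castSucc, Finset.prod_range_succ, Fin.prod_univ_castSucc]
    push_cast
    ring

end Matrix.IsOddRankOne

universe u in
theorem exists_commRing_hom_of_commute {ι : Type*} {A : Type u} [Ring A] {y : ι → A}
    (hy : ∀ i j, Commute (y i) (y j)) :
    ∃ (B : Type u) (_ : CommRing B) (φ : B →+* A) (x : ι → B),
      Function.Injective φ ∧ ∀ i, φ (x i) = y i := by
  have hcomm : ∀ a ∈ Set.range y, ∀ b ∈ Set.range y, a * b = b * a := by
    rintro _ ⟨i, rfl⟩ _ ⟨j, rfl⟩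
    exact hy i j
  have := Subring.isMulCommutative_closure hcomm
  open scoped IsMulCommutative in
  exact ⟨Subring.closure (Set.range y), inferInstance, Subring.subtype _,
    fun i => ⟨y i, Subring.subset_closure ⟨i, rfl⟩⟩, Subtype.val_injective, fun _ => rfl⟩

theorem prod_factorial_mul_choose (k l : ℕ) :
    ((∏ s ∈ Finset.range l, k.factorial * (s + k).choose s : ℕ) : ℝ) =
      (∏ j ∈ Finset.range (k + l), (j.factorial : ℝ)) /
        ((∏ j ∈ Finset.range k, (j.factorial : ℝ)) *
          ∏ j ∈ Finset.range l, (j.factorial : ℝ)) := by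
  have h0 : ∀ m, (∏ j ∈ Finset.range m, (j.factorial : ℝ)) ≠ 0 := fun m =>
    Finset.prod_ne_zero_iff.2 fun j _ => by positivity
  induction l with
  | zero => simp [div_self (h0 k)]
  | succ l ih =>
    have h : ((l + k).choose l * l.factorial * k.factorial : ℝ) = (l + k).factorial := by
      rw [Nat.choose_symm_add]
      exact_mod_cast Nat.add_choose_mul_factorial_mul_factorial l k
    rw [Finset.prod_range_succ, Nat.cast_mul, ih, ← add_assoc, Finset.prod_range_succ,
      Finset.prod_range_succ _ l, add_comm k l, ← h]
    have := h0 k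
    have := h0 l
    have : (l.factorial : ℝ) ≠ 0 := by positivity
    field_simp
    push_cast
    ring

theorem commute_mul_mul_of_anticommute {A : Type*} [Ring A] {a b c d : A}
    (hac : a * c = -(c * a)) (had : a * d = -(d * a)) (hbc : b * c = -(c * b))
    (hbd : b * d = -(d * b)) : Commute (a * b) (c * d) := by
  calc a * b * (c * d) = a * (b * c) * d := by noncomm_ring
    _ = -(a * c * (b * d)) := by rw [hbc]; noncomm_ring
    _ = -(c * (a * d) * b) := by rw [hbd, hac]; noncomm_ring
    _ = c * d * (a * b) := by rw [had]; noncomm_ring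

theorem mul_mul_add_mul_mul_of_anticommute {A : Type*} [Ring A] {a b c d : A}
    (hbc : b * c = -(c * b)) (hdc : d * c = -(c * d)) (hbd : b * d = -(d * b)) :
    a * b * (c * d) + a * d * (c * b) = 0 := by
  calc a * b * (c * d) + a * d * (c * b) = a * (b * c) * d + a * (d * c) * b := by noncomm_ring
    _ = -(a * c * (b * d)) - a * c * (d * b) := by rw [hbc, hdc]; noncomm_ring
    _ = 0 := by rw [hbd]; noncomm_ring

/-- `det(Ω)^l = C(l,k) · ∏_{s,i} ψ^i_s ∧ ψ̄^i_s` with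
`C(l,k) = (∏_{j=0}^{k+l-1} j!) / ((∏_{j=0}^{k-1} j!)(∏_{j=0}^{l-1} j!))`. -/
theorem detOmega_pow_eq_factorial_ratio_smul_topProd (k l : ℕ) (hk : 0 < k) (hl : 0 < l) :
    detOmega k l ^ l =
      ((∏ j ∈ Finset.range (k + l), (j.factorial : ℝ)) /
        ((∏ j ∈ Finset.range k, (j.factorial : ℝ)) *
          ∏ j ∈ Finset.range l, (j.factorial : ℝ))) • topProd k l := by
  have hanti : ∀ a b, ExteriorAlgebra.ι ℝ a * ExteriorAlgebra.ι ℝ b =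
      -(ExteriorAlgebra.ι ℝ b * ExteriorAlgebra.ι ℝ a :
        ExteriorAlgebra ℝ (((Fin k × Fin l) ⊕ (Fin k × Fin l)) → ℝ)) := fun a b =>
    eq_neg_of_add_eq_zero_left (ExteriorAlgebra.ι_add_mul_swap a b)
  have hcomm : ∀ p q : Fin l × Fin k × Fin k,
      Commute (psi k l p.2.1 p.1 * psibar k l p.2.2 p.1)
        (psi k l q.2.1 q.1 * psibar k l q.2.2 q.1) := fun p q =>
    commute_mul_mul_of_anticommute (hanti _ _) (hanti _ _) (hanti _ _) (hanti _ _)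
  obtain ⟨B, _, φ, x, hφ, hx⟩ := exists_commRing_hom_of_commute hcomm
  let : Module ℚ (Lam k l) := Module.compHom _ (algebraMap ℚ ℝ)
  have : IsAddTorsionFree (Lam k l) := .of_module_rat _
  have : IsAddTorsionFree B := Function.Injective.isAddTorsionFree φ.toAddMonoidHom hφ
  have hrel : ∀ s, (Matrix.of fun i j => x (s, i, j)).IsOddRankOne := by
    intro s i j p q
    apply hφ
    simp only [Matrix.of_apply, map_add, map_mul, hx, map_zero]
    exact mul_mul_add_mul_mul_of_anticommute (hanti _ _) (hanti _ _) (hanti _ _)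
  have hdet : φ (Matrix.det (∑ s, Matrix.of fun i j => x (s, i, j))) = detOmega k l := by
    rw [← Matrix.det_transpose, Matrix.det_apply, map_sum, detOmega]
    refine Finset.sum_congr rfl fun σ _ => ?_
    rw [Units.smul_def, map_zsmul, ← List.prod_ofFn, map_list_prod, List.map_ofFn]
    simp [Function.comp_def, Matrix.sum_apply, hx, Omega]
  have htop : φ (∏ s, ∏ i, x (s, i, i)) = topProd k l := by
    simp only [← List.prod_ofFn, map_list_prod, List.map_ofFn, Function.comp_def, hx, topProd]
  have h := congrArg φ (Matrix.IsOddRankOne.det_sum_pow hrel)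
  rw [map_pow, hdet, map_mul, map_natCast, Fintype.card_fin] at h
  rw [h, ← prod_factorial_mul_choose, Nat.cast_smul_eq_nsmul, nsmul_eq_mul, ← htop]
  rfl
end

section
/- Let N and k be integers with 0 < k < N and set l = N−k. In the exterior algebra Λ on the 2k(N−k) generators ψ^i_s, ψ̄^i_s (1≤i≤k, 1≤s≤N−k), one has ((∏_{j=0}^{k-1} j!)/(∏_{j=N-k}^{N-1} j!)) · det(Ω)^{N-k} = ∏_{s=1}^{N-k} ∏_{i=1}^{k} (ψ^i_s ∧ ψ̄^i_s); equivalently, det(Ω)^{N-k} = ((∏_{j=N-k}^{N-1} j!)/(∏_{j=0}^{k-1} j!)) · ∏_{s=1}^{N-k} ∏_{i=1}^{k} (ψ^i_s ∧ ψ̄^i_s). -/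
open scoped BigOperators

theorem Finset.sum_pow_card_add_one_eq_zero {A κ : Type*} [CommSemiring A] (s : Finset κ)
    (x : κ → A) (hx : ∀ i ∈ s, x i ^ 2 = 0) : (∑ i ∈ s, x i) ^ (s.card + 1) = 0 := by
  classical
  induction s using Finset.induction_on with
  | empty => simp
  | insert a s ha ih =>
    rw [Finset.sum_insert ha, Finset.card_insert_of_notMem ha]
    refine (Commute.all _ _).add_pow_eq_zero_of_add_le_succ_of_pow_eq_zero
      (hx a (Finset.mem_insert_self _ _)) (ih fun i hi => hx i (Finset.mem_insert_of_mem hi)) ?_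
    omega

/-- The polynomials `p` whose coefficient of degree `d` lies in `I ^ (m - d)` for all `d`. -/
def Polynomial.CoeffMemPow {R : Type*} [CommRing R] (I : Ideal R) (m : ℕ) (p : Polynomial R) :
    Prop :=
  ∀ d, p.coeff d ∈ I ^ (m - d)

theorem Polynomial.CoeffMemPow.mul {R : Type*} [CommRing R] {I : Ideal R} {m m' : ℕ}
    {p q : Polynomial R} (hp : p.CoeffMemPow I m) (hq : q.CoeffMemPow I m') : (p * q).CoeffMemPow I (m + m') := by
  intro d
  rw [Polynomial.coeff_mul]
  refine Ideal.sum_mem _ fun x hx => ?_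
  have hx := Finset.HasAntidiagonal.mem_antidiagonal.1 hx
  refine Ideal.pow_le_pow_right (by omega : m + m' - d ≤ (m - x.1) + (m' - x.2)) ?_
  rw [pow_add]
  exact Ideal.mul_mem_mul (hp _) (hq _)

theorem Polynomial.CoeffMemPow.one {R : Type*} [CommRing R] (I : Ideal R) :
    (1 : Polynomial R).CoeffMemPow I 0 := by
  intro d; simp

theorem Polynomial.CoeffMemPow.prod {R : Type*} [CommRing R] {I : Ideal R} {κ : Type*} (s : Finset κ)
    {m : ℕ} {p : κ → Polynomial R} (hp : ∀ i, (p i).CoeffMemPow I m) :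
    (∏ i ∈ s, p i).CoeffMemPow I (s.card * m) := by
  classical
  induction s using Finset.induction_on with
  | empty => simpa using Polynomial.CoeffMemPow.one I
  | insert a s ha ih =>
    rw [Finset.prod_insert ha, Finset.card_insert_of_notMem ha, add_mul, one_mul, add_comm]
    exact (hp a).mul ih

open Polynomial in
theorem Matrix.map_coeff_det_X_add_C_pow {ι R S : Type*} [Fintype ι] [DecidableEq ι]
    [CommRing R] [CommRing S] (φ : R →+* S) (Y M : Matrix ι ι R) (n d : ℕ) :
    φ (((Matrix.det ((X : R[X]) • Y.map C + M.map C)) ^ n).coeff d) =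
      ((Matrix.det ((X : S[X]) • (Y.map φ).map C + (M.map φ).map C)) ^ n).coeff d := by
  rw [← coeff_map, Polynomial.map_pow, ← coe_mapRingHom, RingHom.map_det]
  congr 3
  ext1 i j
  simp

open Polynomial in
theorem Matrix.coeffMemPow_det_X_add_C_pow {ι R : Type*} [Fintype ι] [DecidableEq ι]
    [CommRing R] {I : Ideal R} {M : Matrix ι ι R}
    (hM : ∀ i j, M i j ∈ I) (Y : Matrix ι ι R) (n : ℕ) :
    ((Matrix.det ((X : R[X]) • Y.map C + M.map C)) ^ n).CoeffMemPow I (n * Fintype.card ι) := by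
  have hdet : (Matrix.det ((X : R[X]) • Y.map C + M.map C)).CoeffMemPow I (Fintype.card ι) := by
    intro d
    rw [Matrix.det_apply, finsetSum_coeff]
    refine Ideal.sum_mem _ fun σ _ => ?_
    rw [Units.smul_def, coeff_smul]
    refine zsmul_mem ?_ _
    have := CoeffMemPow.prod (I := I) (m := 1) Finset.univ
      (p := fun i => ((X : R[X]) • Y.map C + M.map C) (σ i) i) fun i e => by
        rcases e with _ | e
        · simpa using hM _ _
        · simp
    simpa using this d
  simpa using CoeffMemPow.prod (Finset.range n) fun _ => hdet

/-- A square matrix over a commutative ring whose entries multiply like the products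
`ψ^i ∧ ψ̄^j` of two families of anticommuting variables. -/
structure Matrix.IsFermionic {ι R : Type*} [CommRing R] (Y : Matrix ι ι R) : Prop where
  mul_swap : ∀ a b c d, Y a b * Y c d = -(Y a d * Y c b)
  mul_self_col : ∀ a c b, Y a b * Y c b = 0

namespace Matrix.IsFermionic

variable {ι R S : Type*} [CommRing R] [CommRing S]

theorem map {Y : Matrix ι ι R} (hY : Y.IsFermionic) (φ : R →+* S) :
    (Y.map φ).IsFermionic where
  mul_swap a b c d := by simp only [map_apply, ← map_mul, ← map_neg, hY.mul_swap a b c d]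
  mul_self_col a c b := by simp only [map_apply, ← map_mul, hY.mul_self_col a c b, map_zero]

theorem smul {Y : Matrix ι ι R} (hY : Y.IsFermionic) (r : R) : (r • Y).IsFermionic where
  mul_swap a b c d := by
    simp only [smul_apply, smul_eq_mul]
    linear_combination r ^ 2 * hY.mul_swap a b c d
  mul_self_col a c b := by
    simp only [smul_apply, smul_eq_mul]
    linear_combination r ^ 2 * hY.mul_self_col a c b

variable [Fintype ι]

theorem mul_left {Y : Matrix ι ι R} (hY : Y.IsFermionic) (A : Matrix ι ι R) :
    (A * Y).IsFermionic where
  mul_swap a b c d := by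
    simp only [mul_apply, Finset.sum_mul_sum, ← Finset.sum_neg_distrib]
    refine Finset.sum_congr rfl fun p _ => Finset.sum_congr rfl fun q _ => ?_
    linear_combination A a p * A c q * hY.mul_swap p b q d
  mul_self_col a c b := by
    simp only [mul_apply, Finset.sum_mul_sum]
    refine Finset.sum_eq_zero fun p _ => Finset.sum_eq_zero fun q _ => ?_
    linear_combination A a p * A c q * hY.mul_self_col p q b

theorem mul_self {Z : Matrix ι ι R} (hZ : Z.IsFermionic) : Z * Z = -(Z.trace • Z) := by
  ext i j
  simp only [mul_apply, neg_apply, smul_apply, smul_eq_mul, trace, diag_apply, Finset.sum_mul,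
    ← Finset.sum_neg_distrib]
  refine Finset.sum_congr rfl fun p _ => ?_
  rw [hZ.mul_swap, mul_comm]

theorem exists_ideal_pow_eq_zero {κ : Type*} [Fintype κ] {Y : κ → Matrix ι ι R}
    (hY : ∀ s, (Y s).IsFermionic) :
    ∃ I : Ideal R, (∀ s i j, Y s i j ∈ I) ∧ I ^ (Fintype.card κ * Fintype.card ι + 1) = 0 := by
  classical
  let J (p : κ × ι) : Ideal R := Ideal.span (Set.range fun i => Y p.1 i p.2)
  refine ⟨∑ p, J p, fun s i j => ?_, ?_⟩
  · have : J (s, j) ≤ ∑ p, J p := by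
      rw [Ideal.sum_eq_sup]
      exact Finset.le_sup (f := J) (Finset.mem_univ _)
    exact this (Ideal.subset_span ⟨i, rfl⟩)
  · have h := Finset.sum_pow_card_add_one_eq_zero Finset.univ J fun p _ => by
      rw [pow_two, Ideal.span_mul_span', Ideal.zero_eq_bot, Ideal.span_eq_bot]
      rintro _ ⟨_, ⟨a, rfl⟩, _, ⟨b, rfl⟩, rfl⟩
      exact (hY p.1).mul_self_col a b p.2
    rwa [Finset.card_univ, Fintype.card_prod] at h

variable [DecidableEq ι]

theorem prod_perm {Y : Matrix ι ι R} (hY : Y.IsFermionic) (σ : Equiv.Perm ι) :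
    ∏ i, Y (σ i) i = ((Equiv.Perm.sign σ : ℤ) : R) * ∏ i, Y i i := by
  induction σ using Equiv.Perm.swap_induction_on' with
  | one => simp
  | mul_swap f x y hxy ih =>
    have hx : x ∈ Finset.univ.erase y := by simp [hxy]
    have key : ∏ i, Y ((f * Equiv.swap x y) i) i = -∏ i, Y (f i) i := by
      rw [← Finset.mul_prod_erase _ _ (Finset.mem_univ y), ← Finset.mul_prod_erase _ _ hx,
        ← Finset.mul_prod_erase _ (fun i => Y (f i) i) (Finset.mem_univ y),
        ← Finset.mul_prod_erase _ (fun i => Y (f i) i) hx, ← mul_assoc, ← mul_assoc, ← neg_mul]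
      congr 1
      · simp only [Equiv.Perm.mul_apply, Equiv.swap_apply_left, Equiv.swap_apply_right]
        rw [hY.mul_swap, mul_comm]
      · refine Finset.prod_congr rfl fun i hi => ?_
        simp only [Finset.mem_erase, Finset.mem_univ, and_true] at hi
        rw [Equiv.Perm.mul_apply, Equiv.swap_apply_of_ne_of_ne hi.1 hi.2]
    rw [key, ih, Equiv.Perm.sign_mul, Equiv.Perm.sign_swap hxy]
    simp

theorem det_eq {Y : Matrix ι ι R} (hY : Y.IsFermionic) :
    Y.det = ((Fintype.card ι).factorial : R) * ∏ i, Y i i := by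
  have h (σ : Equiv.Perm ι) : Equiv.Perm.sign σ • ∏ i, Y (σ i) i = ∏ i, Y i i := by
    rw [hY.prod_perm, Units.smul_def, zsmul_eq_mul, ← mul_assoc, ← Int.cast_mul,
      ← Units.val_mul, Int.units_mul_self]
    simp
  simp only [det_apply, h, Finset.sum_const, Finset.card_univ, Fintype.card_perm, nsmul_eq_mul]

theorem det_one_add_mul_of_rows (s : Finset ι) : ∀ Z : Matrix ι ι R, Z.IsFermionic →
    (∀ i ∉ s, ∀ j, Z i j = 0) → (1 + Z).det * (1 - Z.trace) = 1 := by
  induction s using Finset.induction_on with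
  | empty =>
    intro Z _ h
    obtain rfl : Z = 0 := by ext i j; exact h i (by simp) j
    simp
  | insert m s hm ih =>
    intro Z hZ h
    set e : ι → R := fun i => if i = m then 0 else 1
    set W := diagonal e * Z with hW
    have hWf : W.IsFermionic := hZ.mul_left _
    have hWm (j : ι) : W m j = 0 := by simp [hW, e]
    have hWne (i : ι) (hi : i ≠ m) (j : ι) : W i j = Z i j := by simp [hW, e, hi]
    have ihW := ih W hWf fun i hi j => by
      by_cases him : i = m
      · rw [him, hWm]
      · rw [hWne i him, h i (by simp [him, hi])]
    set a := (1 + W).det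
    set u : ι → R := Pi.single m 1
    set v : ι → R := fun j => Z m j
    have hinv : (1 + W)⁻¹ = 1 - a • W := by
      refine inv_eq_right_inv ?_
      rw [mul_sub, mul_one, add_mul, one_mul, mul_smul_comm, hWf.mul_self, smul_neg, smul_smul]
      have : a * W.trace = a - 1 := by linear_combination -ihW
      rw [this, sub_smul, one_smul]
      abel
    have hdec : 1 + Z = (1 + W) + replicateCol Unit u * replicateRow Unit v := by
      rw [add_assoc]
      congr 1
      ext i j
      by_cases him : i = m
      · subst him; simp [mul_apply, hWm, u, v]
      · simp [mul_apply, hWne i him, him, u]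
    have htr : Z.trace = W.trace + Z m m := by
      simp only [trace, diag_apply]
      rw [← Finset.add_sum_erase _ _ (Finset.mem_univ m),
        ← Finset.add_sum_erase _ (fun i => W i i) (Finset.mem_univ m), hWm, zero_add, add_comm]
      congr 1
      exact Finset.sum_congr rfl fun i hi => (hWne i (Finset.ne_of_mem_erase hi) i).symm
    have hZW : (Z * W) m m = -(W.trace * Z m m) := by
      simp only [mul_apply, trace, diag_apply, Finset.sum_mul, ← Finset.sum_neg_distrib]
      refine Finset.sum_congr rfl fun i _ => ?_
      by_cases him : i = m
      · simp [him, hWm]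
      · rw [hWne i him, hWne i him, hZ.mul_swap, mul_comm]
    have hdet : (1 + replicateRow Unit v * (1 + W)⁻¹ * replicateCol Unit u).det
        = 1 + a * Z m m := by
      have : Z m m - a * (Z * W) m m = a * Z m m := by
        rw [hZW]; linear_combination -(Z m m) * ihW
      rw [← this, hinv, det_unique, Matrix.mul_sub, Matrix.sub_mul]
      simp [mul_apply, Finset.mul_sum, mul_left_comm, u, v, Pi.single_apply]
    rw [hdec, det_add_replicateCol_mul_replicateRow (IsUnit.of_mul_eq_one _ ihW), hdet, htr]
    linear_combination (1 + a * Z m m) * ihW - a ^ 2 * hZ.mul_self_col m m m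

theorem det_one_add_mul {Z : Matrix ι ι R} (hZ : Z.IsFermionic) :
    (1 + Z).det * (1 - Z.trace) = 1 :=
  det_one_add_mul_of_rows Finset.univ Z hZ fun i hi => absurd (Finset.mem_univ i) hi

open Polynomial in
theorem coeff_det_X_add_one_pow {Z : Matrix ι ι R} (hZ : Z.IsFermionic) (n d : ℕ) :
    ((det ((X : R[X]) • Z.map C + (1 : Matrix ι ι R).map C)) ^ (n + 1)).coeff d =
      ((n + d).choose n : R) * Z.trace ^ d := by
  have h := ((hZ.map C).smul X).det_one_add_mul
  have hone : (1 : Matrix ι ι R).map C = 1 := by ext i j; simp [one_apply, apply_ite]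
  have htr : ((X : R[X]) • Z.map C).trace = C Z.trace * X := by
    rw [trace_smul, smul_eq_mul, mul_comm]
    simp [trace, map_sum]
  rw [hone, add_comm]
  set f := (1 + (X : R[X]) • Z.map C).det
  rw [htr] at h
  have hf : (f : PowerSeries R) * (1 - PowerSeries.rescale Z.trace PowerSeries.X) = 1 := by
    rw [PowerSeries.rescale_X]
    simpa using congrArg (Polynomial.toPowerSeries) h
  have hg := congrArg (PowerSeries.rescale Z.trace)
    (PowerSeries.mk_add_choose_mul_one_sub_pow_eq_one (S := R) n)
  rw [map_mul, map_pow, map_sub, map_one] at hg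
  have hfg : (f : PowerSeries R) ^ (n + 1) = PowerSeries.rescale Z.trace
      (PowerSeries.mk fun d => ((n + d).choose n : R)) := by
    rw [← mul_one (_ ^ _), ← hg, mul_left_comm, ← mul_pow, hf, one_pow, mul_one]
  rw [← Polynomial.coeff_coe, Polynomial.coe_pow, hfg, PowerSeries.coeff_rescale,
    PowerSeries.coeff_mk, mul_comm]

theorem trace_pow {Z : Matrix ι ι R} (hZ : Z.IsFermionic) :
    Z.trace ^ Fintype.card ι = Z.det := by
  have h := hZ.coeff_det_X_add_one_pow 0 (Fintype.card ι)
  rw [zero_add, pow_one, Polynomial.coeff_det_X_add_C_card] at h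
  simpa using h.symm

theorem trace_pow_eq_zero {Z : Matrix ι ι R} (hZ : Z.IsFermionic) {d : ℕ}
    (hd : Fintype.card ι < d) : Z.trace ^ d = 0 := by
  have h := hZ.coeff_det_X_add_one_pow 0 d
  rw [zero_add, pow_one, Polynomial.coeff_eq_zero_of_natDegree_lt
    ((Polynomial.natDegree_det_X_add_C_le _ _).trans_lt hd)] at h
  simpa using h.symm

open Polynomial in
theorem coeff_det_X_add_C_pow_of_isUnit {Y M : Matrix ι ι R} (hY : Y.IsFermionic)
    (hM : IsUnit M.det) (n d : ℕ) :
    ((det ((X : R[X]) • Y.map C + M.map C)) ^ (n + 1)).coeff d =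
      M.det ^ (n + 1) * (((n + d).choose n : R) * (M⁻¹ * Y).trace ^ d) := by
  have hdec : (X : R[X]) • Y.map C + M.map C =
      M.map C * ((X : R[X]) • (M⁻¹ * Y).map C + (1 : Matrix ι ι R).map C) := by
    rw [Matrix.mul_add, Matrix.mul_smul, ← Matrix.map_mul, ← Matrix.map_mul, Matrix.mul_one,
      mul_nonsing_inv_cancel_left _ _ hM]
  have hdet : (M.map C).det = C M.det := (RingHom.map_det (C : R →+* R[X]) M).symm
  rw [hdec, det_mul, mul_pow, hdet, ← C_pow, coeff_C_mul, (hY.mul_left _).coeff_det_X_add_one_pow]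

open Polynomial in
theorem coeff_det_X_add_C_pow_card {Y : Matrix ι ι R} (hY : Y.IsFermionic) (M : Matrix ι ι R)
    (n : ℕ) :
    ((det ((X : R[X]) • Y.map C + M.map C)) ^ (n + 1)).coeff (Fintype.card ι) =
      ((n + Fintype.card ι).choose n : R) * (M.det ^ n * Y.det) ∧
    ∀ d, Fintype.card ι < d →
      ((det ((X : R[X]) • Y.map C + M.map C)) ^ (n + 1)).coeff d = 0 := by
  set G : Matrix ι ι R[X] := (X : R[X]) • (1 : Matrix ι ι R).map C + M.map C
  have hG : G.det ∈ nonZeroDivisors R[X] :=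
    Monic.mem_nonZeroDivisors <| by
      have hone : (1 : Matrix ι ι R).map C = (1 : Matrix ι ι R[X]) := by simp
      simpa only [G, hone, Monic.def] using leadingCoeff_det_X_one_add_C M
  set φ := algebraMap R[X] (FractionRing R[X])
  have hφ : Function.Injective φ := IsFractionRing.injective _ _
  have hY' := hY.map (C : R →+* R[X])
  have hYF := hY'.map φ
  have hu : IsUnit (G.map φ).det := by
    rw [← RingHom.mapMatrix_apply, ← RingHom.map_det]
    exact IsLocalization.map_units (M := nonZeroDivisors R[X]) _ ⟨_, hG⟩
  have hM : G.map (evalRingHom 0) = M := by ext i j; simp [G]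
  have hYC : (Y.map (C : R →+* R[X])).map (evalRingHom 0) = Y := by ext i j; simp
  have hcoeff (d : ℕ) : ((det ((X : R[X]) • Y.map C + M.map C)) ^ (n + 1)).coeff d =
      evalRingHom 0 (((det ((X : R[X][X]) • (Y.map (C : R →+* R[X])).map C + G.map C)) ^
        (n + 1)).coeff d) := by
    rw [map_coeff_det_X_add_C_pow, hM, hYC]
  refine ⟨?_, fun d hd => ?_⟩
  · have key : ((det ((X : R[X][X]) • (Y.map (C : R →+* R[X])).map C + G.map C)) ^
        (n + 1)).coeff (Fintype.card ι) =
        ((n + Fintype.card ι).choose n : R[X]) * (G.det ^ n * (Y.map (C : R →+* R[X])).det) := by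
      apply hφ
      rw [map_coeff_det_X_add_C_pow, hYF.coeff_det_X_add_C_pow_of_isUnit hu,
        (hYF.mul_left _).trace_pow, det_mul, det_nonsing_inv]
      simp only [map_mul, map_pow, map_natCast, RingHom.map_det, RingHom.mapMatrix_apply]
      have := Ring.mul_inverse_cancel _ hu
      linear_combination ((n + Fintype.card ι).choose n : FractionRing R[X]) *
        (G.map φ).det ^ n * ((Y.map (C : R →+* R[X])).map φ).det * this
    rw [hcoeff, key]
    simp only [map_mul, map_pow, map_natCast, RingHom.map_det, RingHom.mapMatrix_apply, hM, hYC]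
  · rw [hcoeff]
    convert map_zero (evalRingHom (0 : R))
    apply hφ
    rw [map_coeff_det_X_add_C_pow, hYF.coeff_det_X_add_C_pow_of_isUnit hu,
      (hYF.mul_left _).trace_pow_eq_zero hd]
    simp

open Polynomial in
theorem det_sum_pow {l : ℕ} (Y : Fin l → Matrix ι ι R) (hY : ∀ s, (Y s).IsFermionic) :
    (∑ s, Y s).det ^ l =
      (∏ n ∈ Finset.range l, ((n + Fintype.card ι).choose n : R)) * ∏ s, (Y s).det := by
  induction l with
  | zero => simp
  | succ l ih =>
    rw [Fin.sum_univ_castSucc, Fin.prod_univ_castSucc, Finset.prod_range_succ]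
    have ih := ih (fun s => Y s.castSucc) fun s => hY _
    obtain ⟨I, hI, hI0⟩ := exists_ideal_pow_eq_zero fun s : Fin l => hY s.castSucc
    set M := ∑ s : Fin l, Y s.castSucc
    have hM (i j : ι) : M i j ∈ I := by
      rw [show M i j = ∑ s : Fin l, Y s.castSucc i j from Matrix.sum_apply i j _ _]
      exact Ideal.sum_mem _ fun s _ => hI s i j
    obtain ⟨hk, hlt⟩ := (hY (Fin.last l)).coeff_det_X_add_C_pow_card M l
    have hmem := coeffMemPow_det_X_add_C_pow hM (Y (Fin.last l)) (l + 1)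
    set f := det ((X : R[X]) • (Y (Fin.last l)).map C + M.map C)
    have hf : (M + Y (Fin.last l)).det = evalRingHom 1 f := by
      rw [RingHom.map_det]
      congr 1
      ext i j
      simp [add_comm]
    have hmono : f ^ (l + 1) = monomial (Fintype.card ι) ((f ^ (l + 1)).coeff (Fintype.card ι)) := by
      ext d
      rw [coeff_monomial]
      split_ifs with h
      · rw [h]
      · rcases lt_or_gt_of_ne h with h | h
        · exact hlt d h
        · have := Ideal.pow_le_pow_right (I := I) (m := Fintype.card (Fin l) * Fintype.card ι + 1)
            (n := (l + 1) * Fintype.card ι - d) (by rw [Fintype.card_fin, add_mul]; omega) (hmem d)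
          rwa [hI0] at this
    rw [hf, ← map_pow, hmono, hk, coe_evalRingHom, eval_monomial, one_pow, mul_one, ih]
    ring

end Matrix.IsFermionic

theorem prod_factorial_mul_prod_choose (k l : ℕ) :
    (∏ j ∈ Finset.range k, j.factorial) *
        ∏ n ∈ Finset.range l, (n + k).choose n * k.factorial =
      ∏ j ∈ Finset.Ico l (l + k), j.factorial := by
  induction l with
  | zero => simp
  | succ l ih =>
    have h := Finset.prod_Ico_succ_top (Nat.le_add_right l k) Nat.factorial
    rw [Finset.prod_eq_prod_Ico_succ_bot (by omega)] at h
    rw [Finset.prod_range_succ, ← mul_assoc, ih]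
    refine Nat.eq_of_mul_eq_mul_left (Nat.factorial_pos l) ?_
    rw [show l + 1 + k = l + k + 1 by omega, h, ← Nat.add_choose_mul_factorial_mul_factorial l k,
      Nat.choose_symm_add]
    ring

theorem ExteriorAlgebra.ι_mul_ι_mem_center {R M : Type*} [CommRing R] [AddCommGroup M]
    [Module R M] (x y : M) :
    ι R x * ι R y ∈ Subalgebra.center R (ExteriorAlgebra R M) := by
  rw [Subalgebra.mem_center_iff]
  intro b
  induction b using ExteriorAlgebra.induction with
  | algebraMap r => exact Algebra.commutes r _
  | ι z =>
    have h1 := ι_add_mul_swap (R := R) z x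
    have h2 := ι_add_mul_swap (R := R) z y
    rw [add_eq_zero_iff_eq_neg] at h1 h2
    rw [← mul_assoc, h1, neg_mul, mul_assoc, h2, mul_neg, neg_neg, mul_assoc]
  | mul a b ha hb => rw [mul_assoc, hb, ← mul_assoc, ha, mul_assoc]
  | add a b ha hb => rw [add_mul, mul_add, ha, hb]

/-- The matrix of products `ψ^i_s ∧ ψ̄^j_s` with `s` fixed, over the centre of the exterior
algebra. -/
noncomputable def pairMatrix (k l : ℕ) (s : Fin l) :
    Matrix (Fin k) (Fin k) (Subalgebra.center ℝ (Lam k l)) :=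
  fun i j => ⟨psi k l i s * psibar k l j s, ExteriorAlgebra.ι_mul_ι_mem_center _ _⟩

theorem pairMatrix_isFermionic (k l : ℕ) (s : Fin l) : (pairMatrix k l s).IsFermionic where
  mul_swap a b c d := by
    apply Subtype.ext
    have hbc : psibar k l b s * psi k l c s = -(psi k l c s * psibar k l b s) :=
      eq_neg_of_add_eq_zero_left (ExteriorAlgebra.ι_add_mul_swap _ _)
    have hdc : psibar k l d s * psi k l c s = -(psi k l c s * psibar k l d s) :=
      eq_neg_of_add_eq_zero_left (ExteriorAlgebra.ι_add_mul_swap _ _)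
    have hbd : psibar k l b s * psibar k l d s = -(psibar k l d s * psibar k l b s) :=
      eq_neg_of_add_eq_zero_left (ExteriorAlgebra.ι_add_mul_swap _ _)
    change psi k l a s * psibar k l b s * (psi k l c s * psibar k l d s) =
      -(psi k l a s * psibar k l d s * (psi k l c s * psibar k l b s))
    rw [mul_assoc, ← mul_assoc (psibar k l b s), hbc, mul_assoc (psi k l a s),
      ← mul_assoc (psibar k l d s), hdc, neg_mul, neg_mul, mul_assoc, hbd, mul_assoc]
    simp
  mul_self_col a c b := by
    apply Subtype.ext
    have hbc : psibar k l b s * psi k l c s = -(psi k l c s * psibar k l b s) :=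
      eq_neg_of_add_eq_zero_left (ExteriorAlgebra.ι_add_mul_swap _ _)
    have hbb : psibar k l b s * psibar k l b s = 0 := ExteriorAlgebra.ι_sq_zero _
    change psi k l a s * psibar k l b s * (psi k l c s * psibar k l b s) = 0
    rw [mul_assoc, ← mul_assoc (psibar k l b s), hbc, neg_mul, mul_assoc, hbb]
    simp

theorem detOmega_eq_coe_det (k l : ℕ) :
    detOmega k l = ((∑ s, pairMatrix k l s).det : Subalgebra.center ℝ (Lam k l)) := by
  rw [← Matrix.det_transpose, Matrix.det_apply, detOmega, ← Subalgebra.coe_val, map_sum]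
  refine Finset.sum_congr rfl fun σ _ => ?_
  rw [Units.smul_def, zsmul_eq_mul, zsmul_eq_mul, map_mul, map_intCast, ← List.prod_ofFn,
    map_list_prod, List.map_ofFn]
  congr 3
  ext a
  simp [Omega, pairMatrix, Matrix.sum_apply]

theorem topProd_eq_coe_prod (k l : ℕ) :
    topProd k l = ((∏ s, ∏ i, pairMatrix k l s i i : Subalgebra.center ℝ (Lam k l)) : Lam k l) := by
  rw [topProd, ← Subalgebra.coe_val, ← List.prod_ofFn, map_list_prod, List.map_ofFn]
  congr 2
  ext s
  rw [Function.comp_apply, ← List.prod_ofFn, map_list_prod, List.map_ofFn]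
  rfl

theorem detOmega_pow_eq_smul_topProd (k l : ℕ) :
    detOmega k l ^ l =
      (∏ n ∈ Finset.range l, (n + k).choose n * k.factorial) • topProd k l := by
  have h := Matrix.IsFermionic.det_sum_pow (pairMatrix k l) (pairMatrix_isFermionic k l)
  simp only [(pairMatrix_isFermionic k l _).det_eq, Finset.prod_mul_distrib, Fintype.card_fin,
    Finset.prod_const, Finset.card_univ] at h
  rw [detOmega_eq_coe_det, topProd_eq_coe_prod, ← Subalgebra.coe_pow, h, ← Subalgebra.coe_val,
    ← map_nsmul]
  congr 1
  simp only [nsmul_eq_mul, Finset.prod_mul_distrib, Finset.prod_const, Finset.card_range]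
  push_cast
  ring

/-- For `0 < k < N`, in the exterior algebra on the `2k(N-k)` generators,
`((∏_{j=0}^{k-1} j!)/(∏_{j=N-k}^{N-1} j!)) · det(Ω)^{N-k} = ∏_{s=1}^{N-k} ∏_{i=1}^{k} ψ^i_s ∧ ψ̄^i_s`. -/
theorem factorial_ratio_smul_detOmega_pow_eq_topProd (N k : ℕ) (hk : 0 < k) (hkN : k < N) :
    ((∏ j ∈ Finset.range k, (j.factorial : ℝ)) /
        (∏ j ∈ Finset.Ico (N - k) N, (j.factorial : ℝ))) • detOmega k (N - k) ^ (N - k) =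
      topProd k (N - k) ∧
    detOmega k (N - k) ^ (N - k) =
      ((∏ j ∈ Finset.Ico (N - k) N, (j.factorial : ℝ)) /
        (∏ j ∈ Finset.range k, (j.factorial : ℝ))) • topProd k (N - k) := by
  obtain ⟨l, rfl⟩ := Nat.exists_eq_add_of_le hkN.le
  rw [Nat.add_sub_cancel_left]
  have hA : (∏ j ∈ Finset.range k, (j.factorial : ℝ)) ≠ 0 :=
    Finset.prod_ne_zero_iff.2 fun j _ => Nat.cast_ne_zero.2 j.factorial_ne_zero
  have hB : (∏ j ∈ Finset.Ico l (k + l), (j.factorial : ℝ)) ≠ 0 :=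
    Finset.prod_ne_zero_iff.2 fun j _ => Nat.cast_ne_zero.2 j.factorial_ne_zero
  have hc := congrArg (Nat.cast : ℕ → ℝ) (prod_factorial_mul_prod_choose k l)
  rw [Nat.cast_mul, Nat.cast_prod, Nat.cast_prod (s := Finset.Ico l (l + k)),
    add_comm l k] at hc
  have h : detOmega k l ^ l = ((∏ j ∈ Finset.Ico l (k + l), (j.factorial : ℝ)) /
      (∏ j ∈ Finset.range k, (j.factorial : ℝ))) • topProd k l := by
    rw [detOmega_pow_eq_smul_topProd, ← Nat.cast_smul_eq_nsmul ℝ, ← hc, mul_div_cancel_left₀ _ hA]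
  refine ⟨?_, h⟩
  rw [h, smul_smul, div_mul_div_cancel₀ hB, div_self hA, one_smul]
end
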